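/- arXiv:1705.01963 — 5 statements merged into one kernel-verified Lean document; each statement's English description precedes it below -/
import Mathlib

section
/- For every deletion probability p ∈ (0,1) and every ε > 0, there exist arbitrarily large block lengths N for which the following holds: there is a code C ⊆ {0,1}^N with |C| ≥ 2^{(1-p)N/110}, together with a decoding map Dec from binary words to {0,1}^N, such that for every codeword c ∈ C, if each of the N bits of c is deleted independently with probability p, then Dec applied to the received word equals c with probability at least 1 − ε. (This is the combinatorial content of the paper's main Theorem 1, dropping the polynomial-time constructibility, encoding, and decoding claims.) -/
/-- The word received when transmitting `c : Fin N → Bool` through a deletion channel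
whose keep-pattern is `S` (bit `i` survives iff `S i = true`): the surviving bits in
increasing order of position. -/
def received {N : ℕ} (c S : Fin N → Bool) : List Bool :=
  ((List.finRange N).filter (fun i => S i)).map c

/-- One step of a right-to-left scan of a binary word.  The state `(z, o, out)` records that the
word scanned so far begins with a chunk of `z` zeros followed by `o` ones, and that the later
chunks decode to `out`; a chunk decodes to `true` iff it has more zeros than ones. -/
def chunkStep (b : Bool) (st : ℕ × ℕ × List Bool) : ℕ × ℕ × List Bool :=
  if b then
    if st.1 = 0 then (0, st.2.1 + 1, st.2.2)
    else (0, 1, decide (st.2.1 < st.1) :: st.2.2)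
  else (st.1 + 1, st.2.1, st.2.2)

/-- The output of a scan: a leading chunk without zeros is discarded. -/
def chunkFinish (st : ℕ × ℕ × List Bool) : List Bool :=
  if st.1 = 0 then st.2.2 else decide (st.2.1 < st.1) :: st.2.2

/-- Whether the scanned word begins with a one, as a number. -/
def startsWithOne (st : ℕ × ℕ × List Bool) : ℕ := if st.1 = 0 ∧ 0 < st.2.1 then 1 else 0

/-- The state of the scan after reading a whole word. -/
def chunkState (y : List Bool) : ℕ × ℕ × List Bool := y.foldr chunkStep (0, 0, [])

/-- Split a word into maximal chunks of the form `0⋯01⋯1` and decode each by majority. -/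
def chunkDecode (y : List Bool) : List Bool := chunkFinish (chunkState y)

theorem chunkState_replicate_false (a : ℕ) (y : List Bool) :
    chunkState (List.replicate a false ++ y) =
      ((chunkState y).1 + a, (chunkState y).2.1, (chunkState y).2.2) := by
  induction a with
  | zero => simp
  | succ a ih =>
    simp only [chunkState, List.replicate_succ, List.cons_append, List.foldr_cons] at ih ⊢
    rw [ih]
    simp [chunkStep, add_assoc]

theorem chunkState_replicate_true (b : ℕ) (y : List Bool) :
    chunkState (List.replicate (b + 1) true ++ y) =
      (0, (if (chunkState y).1 = 0 then (chunkState y).2.1 else 0) + (b + 1), chunkDecode y) := by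
  induction b with
  | zero =>
    simp only [chunkDecode, chunkState, List.replicate_succ, List.cons_append, List.foldr_cons,
      List.replicate_zero, List.nil_append, chunkStep, chunkFinish]
    by_cases h : (y.foldr chunkStep (0, 0, [])).1 = 0
    · simp [h]
    · simp only [h]
      rfl
  | succ b ih =>
    rw [List.replicate_succ, List.cons_append]
    simp only [chunkState, List.foldr_cons] at ih ⊢
    rw [ih]
    simp [chunkStep, add_assoc]

/-- A received block `0^a 1^b` is reliable for the symbol `v` if `v` occurs in it, but strictly
less often than `!v`; this is the penalty charged for an unreliable block. -/
def blockPenalty (v : Bool) (a b : ℕ) : ℕ :=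
  if 0 < cond v b a ∧ cond v b a < cond v a b then 0 else 1

theorem exists_common_sublist_chunkDecode (bs : List (Bool × ℕ × ℕ)) :
    ∃ s : List Bool,
      s.Sublist (bs.map Prod.fst) ∧
      s.Sublist (chunkDecode (bs.map fun t =>
        List.replicate t.2.1 false ++ List.replicate t.2.2 true).flatten) ∧
      bs.length + startsWithOne (chunkState (bs.map fun t =>
        List.replicate t.2.1 false ++ List.replicate t.2.2 true).flatten) ≤
        s.length + 2 * (bs.map fun t => blockPenalty t.1 t.2.1 t.2.2).sum ∧
      (chunkDecode (bs.map fun t =>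
        List.replicate t.2.1 false ++ List.replicate t.2.2 true).flatten).length ≤ bs.length := by
  induction bs with
  | nil => exact ⟨[], by simp [chunkDecode, chunkState, chunkFinish, startsWithOne]⟩
  | cons t bs ih =>
    obtain ⟨s, hsx, hsz, hlen, hle⟩ := ih
    obtain ⟨v, a, b⟩ := t
    simp only [List.map_cons, List.flatten_cons, List.sum_cons, List.length_cons,
      List.append_assoc]
    generalize hy : (bs.map fun t : Bool × ℕ × ℕ =>
      List.replicate t.2.1 false ++ List.replicate t.2.2 true).flatten = y at *
    rcases Nat.eq_zero_or_pos b with rfl | hb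
    · simp only [List.replicate_zero, List.nil_append]
      have hpen : blockPenalty v a 0 = 1 := by cases v <;> simp [blockPenalty]
      rw [hpen]
      rcases Nat.eq_zero_or_pos a with rfl | ha
      · refine ⟨s, hsx.cons _, by simpa using hsz, ?_, by simp; omega⟩
        simp only [List.replicate_zero, List.nil_append]
        omega
      · have hd : chunkDecode (List.replicate a false ++ y) =
            decide ((chunkState y).2.1 < (chunkState y).1 + a) :: (chunkState y).2.2 := by
          simp [chunkDecode, chunkState_replicate_false, chunkFinish, ha.ne']
        have hs : s.tail.Sublist (chunkState y).2.2 ∧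
            (chunkState y).2.2.length ≤ (chunkDecode y).length := by
          unfold chunkDecode chunkFinish at hsz ⊢
          split_ifs at hsz ⊢
          · exact ⟨(List.tail_sublist s).trans hsz, le_rfl⟩
          · exact ⟨hsz.tail, by simp⟩
        refine ⟨s.tail, ((List.tail_sublist s).trans hsx).cons _, hd ▸ hs.1.cons _, ?_, ?_⟩
        · rw [chunkState_replicate_false, startsWithOne, if_neg (by simp; omega), List.length_tail]
          omega
        · rw [hd, List.length_cons]
          omega
    · obtain ⟨b, rfl⟩ : ∃ b', b = b' + 1 := ⟨b - 1, by omega⟩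
      have hst := chunkState_replicate_true b y
      have hst' := chunkState_replicate_false a (List.replicate (b + 1) true ++ y)
      rw [hst] at hst'
      rcases Nat.eq_zero_or_pos a with rfl | ha
      · have hpen : blockPenalty v 0 (b + 1) = 1 := by cases v <;> simp [blockPenalty]
        have hd : chunkDecode (List.replicate 0 false ++ (List.replicate (b + 1) true ++ y)) =
            chunkDecode y := by
          rw [chunkDecode, hst']; simp [chunkFinish]
        refine ⟨s, hsx.cons _, hd ▸ hsz, ?_, by rw [hd]; omega⟩
        rw [hpen, hst', startsWithOne, if_pos (by simp)]
        omega
      · set o := if (chunkState y).1 = 0 then (chunkState y).2.1 else 0 with ho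
        have hd : chunkDecode (List.replicate a false ++ (List.replicate (b + 1) true ++ y)) =
            decide (o + (b + 1) < a) :: chunkDecode y := by
          rw [chunkDecode, hst']; simp [chunkFinish, ha.ne']
        rw [hst', hd, startsWithOne, if_neg (by simp; omega)]
        by_cases hgood : blockPenalty v a (b + 1) = 0 ∧ o = 0
        · have hv : decide (o + (b + 1) < a) = v := by
            have := hgood.1
            rw [hgood.2]
            cases v <;> simp [blockPenalty] at this ⊢ <;> omega
          rw [hv]
          refine ⟨v :: s, hsx.cons_cons v, hsz.cons_cons v, ?_, ?_⟩ <;>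
            simp only [List.length_cons] <;> omega
        · refine ⟨s, hsx.cons _, hsz.cons _, ?_, ?_⟩
          · have : blockPenalty v a (b + 1) = 0 ∨ blockPenalty v a (b + 1) = 1 := by
              unfold blockPenalty; split_ifs <;> simp
            by_cases h0 : o = 0
            · omega
            · have : (chunkState y).1 = 0 ∧ 0 < (chunkState y).2.1 := by
                split_ifs at ho with h
                · exact ⟨h, by omega⟩
                · exact absurd ho h0
              rw [startsWithOne, if_pos this] at hlen
              omega
          · simp only [List.length_cons]; omega

theorem exists_common_sublist_of_sublist {α : Type*} {s₁ s₂ z : List α}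
    (h₁ : s₁.Sublist z) (h₂ : s₂.Sublist z) :
    ∃ t : List α, t.Sublist s₁ ∧ t.Sublist s₂ ∧ s₁.length + s₂.length ≤ z.length + t.length := by
  induction h₁ generalizing s₂ with
  | slnil => exact ⟨[], by simp_all⟩
  | cons a h ih =>
    cases h₂ with
    | cons _ h₂ =>
      obtain ⟨t, h1, h2, h3⟩ := ih h₂
      exact ⟨t, h1, h2, by simp; omega⟩
    | cons_cons _ h₂ =>
      obtain ⟨t, h1, h2, h3⟩ := ih h₂
      exact ⟨t, h1, h2.cons _, by simp; omega⟩
  | cons_cons a h ih =>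
    cases h₂ with
    | cons _ h₂ =>
      obtain ⟨t, h1, h2, h3⟩ := ih h₂
      exact ⟨t, h1.cons _, h2, by simp; omega⟩
    | cons_cons _ h₂ =>
      obtain ⟨t, h1, h2, h3⟩ := ih h₂
      exact ⟨a :: t, h1.cons_cons _, h2.cons_cons _, by simp; omega⟩

/-- All binary words of length `n` containing `t` as a subsequence. -/
def superwords : ℕ → List Bool → Finset (List Bool)
  | 0, [] => {[]}
  | 0, _ :: _ => ∅
  | n + 1, [] =>
      (superwords n []).image (List.cons true) ∪ (superwords n []).image (List.cons false)
  | n + 1, b :: t =>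
      (superwords n t).image (List.cons b) ∪ (superwords n (b :: t)).image (List.cons (!b))

theorem mem_superwords {t l : List Bool} (h : t.Sublist l) : l ∈ superwords l.length t := by
  induction l generalizing t with
  | nil => simp_all [superwords]
  | cons a l ih =>
    cases t with
    | nil => cases a <;> simp [superwords, ih (List.nil_sublist l)]
    | cons b t =>
      by_cases hab : a = b
      · subst hab
        simp [superwords, ih (List.cons_sublist_cons.1 h)]
      · have : a = !b := by cases a <;> cases b <;> simp_all
        subst this
        simp [superwords, ih (h.of_cons_of_ne (Ne.symm hab))]

theorem card_superwords_mul_le (n : ℕ) (t : List Bool) :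
    (superwords n t).card * 16 ^ t.length ≤ 17 ^ n := by
  induction n generalizing t with
  | zero => cases t <;> simp [superwords]
  | succ n ih =>
    cases t with
    | nil =>
      have h1 := ih []
      have h2 := Finset.card_union_le ((superwords n []).image (List.cons true))
        ((superwords n []).image (List.cons false))
      have h3 := Finset.card_image_le (s := superwords n []) (f := List.cons true)
      have h4 := Finset.card_image_le (s := superwords n []) (f := List.cons false)
      simp only [superwords, List.length_nil, pow_zero, mul_one, pow_succ] at h1 ⊢
      omega
    | cons b t =>
      have h1 := ih t
      have h1' := ih (b :: t)
      have h2 := Finset.card_union_le ((superwords n t).image (List.cons b))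
        ((superwords n (b :: t)).image (List.cons (!b)))
      have h3 := Finset.card_image_le (s := superwords n t) (f := List.cons b)
      have h4 := Finset.card_image_le (s := superwords n (b :: t)) (f := List.cons (!b))
      simp only [superwords, List.length_cons, pow_succ] at h1' ⊢
      calc _ ≤ ((superwords n t).card + (superwords n (b :: t)).card) * (16 ^ t.length * 16) := by
            gcongr; omega
        _ ≤ _ := by linarith

theorem choose_mul_pow_le (n k : ℕ) : n.choose k * 16 ^ k ≤ 17 ^ n := by
  rcases le_or_gt k n with h | h
  · have := add_pow 16 1 n
    norm_num at this
    rw [this, mul_comm]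
    exact Finset.single_le_sum (f := fun m => 16 ^ m * n.choose m) (fun _ _ => Nat.zero_le _)
      (Finset.mem_range.2 (by omega))
  · simp [Nat.choose_eq_zero_of_lt h]

/-- A Gilbert–Varshamov bound: if every point is in conflict with at most `V` points, then there is
a conflict-free set whose cardinality is at least the total number of points divided by `V`. -/
theorem exists_conflict_free {X : Type*} [Fintype X] [DecidableEq X] (r : X → X → Prop)
    [DecidableRel r] (hrefl : ∀ x, r x x) (hsymm : ∀ x y, r x y → r y x) (V : ℕ)
    (hV : ∀ x, (Finset.univ.filter (r x)).card ≤ V) :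
    ∃ C : Finset X, (∀ x ∈ C, ∀ y ∈ C, r x y → x = y) ∧ Fintype.card X ≤ C.card * V := by
  obtain ⟨C, hC⟩ := Set.Finite.exists_maximal
    (Set.toFinite {C : Finset X | ∀ x ∈ C, ∀ y ∈ C, r x y → x = y}) ⟨∅, by simp⟩
  refine ⟨C, hC.prop, ?_⟩
  have hcover : (Finset.univ : Finset X) ⊆ C.biUnion fun x => Finset.univ.filter (r x) := by
    intro z _
    by_contra hz
    have hz' : ∀ x ∈ C, ¬ r x z := by simpa using hz
    have hmem : z ∈ C := by
      refine hC.le_of_ge (y := insert z C) ?_ (Finset.subset_insert z C)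
        (Finset.mem_insert_self z C)
      intro x hx y hy hxy
      rcases Finset.mem_insert.1 hx with rfl | hx' <;>
        rcases Finset.mem_insert.1 hy with rfl | hy'
      · rfl
      · exact absurd (hsymm _ _ hxy) (hz' _ hy')
      · exact absurd hxy (hz' _ hx')
      · exact hC.prop x hx' y hy' hxy
    exact hz' z hmem (hrefl z)
  calc Fintype.card X ≤ _ := Finset.card_le_card hcover
    _ ≤ C.card * V := Finset.card_biUnion_le_card_mul _ _ _ fun x _ => hV x

/-- A large family of binary words no two of which have a long common subsequence. -/
theorem exists_code_common_sublist (m : ℕ) :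
    ∃ C : Finset (Fin (200 * m) → Bool), 2 ^ (82 * m) ≤ C.card ∧
      ∀ x ∈ C, ∀ x' ∈ C, ∀ t : List Bool, t.Sublist (List.ofFn x) → t.Sublist (List.ofFn x') →
        196 * m ≤ t.length → x = x' := by
  classical
  set r : (Fin (200 * m) → Bool) → (Fin (200 * m) → Bool) → Prop := fun x x' =>
    ∃ t : List Bool, t.Sublist (List.ofFn x) ∧ t.Sublist (List.ofFn x') ∧ t.length = 196 * m
  have hV : ∀ x, (Finset.univ.filter (r x)).card ≤ 2 ^ (118 * m) := by
    intro x
    have hsub : (Finset.univ.filter (r x)).image List.ofFn ⊆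
        ((List.ofFn x).sublistsLen (196 * m)).toFinset.biUnion (superwords (200 * m)) := by
      intro l hl
      obtain ⟨x', hx', rfl⟩ := Finset.mem_image.1 hl
      obtain ⟨t, h1, h2, h3⟩ := (Finset.mem_filter.1 hx').2
      refine Finset.mem_biUnion.2 ⟨t, by simp [List.mem_sublistsLen, h1, h3], ?_⟩
      simpa using mem_superwords h2
    have hcard := Finset.card_le_card hsub
    rw [Finset.card_image_of_injective _ List.ofFn_injective] at hcard
    have hc1 : ((List.ofFn x).sublistsLen (196 * m)).toFinset.card ≤
        (200 * m).choose (196 * m) := by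
      refine (List.toFinset_card_le _).trans ?_
      simp [List.length_sublistsLen]
    have hc2 : (((List.ofFn x).sublistsLen (196 * m)).toFinset.biUnion
        (superwords (200 * m))).card ≤
          (200 * m).choose (196 * m) * (17 ^ (200 * m) / 16 ^ (196 * m)) := by
      refine (Finset.card_biUnion_le_card_mul _ _ (17 ^ (200 * m) / 16 ^ (196 * m)) ?_).trans
        (Nat.mul_le_mul_right _ hc1)
      intro t ht
      have hl : t.length = 196 * m := (List.mem_sublistsLen.1 (List.mem_toFinset.1 ht)).2
      rw [Nat.le_div_iff_mul_le (by positivity), ← hl]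
      exact card_superwords_mul_le _ _
    have h16 : 0 < 16 ^ (196 * m) * 16 ^ (196 * m) := by positivity
    refine hcard.trans (hc2.trans (Nat.le_of_mul_le_mul_right ?_ h16))
    calc _ = ((200 * m).choose (196 * m) * 16 ^ (196 * m)) *
          (17 ^ (200 * m) / 16 ^ (196 * m) * 16 ^ (196 * m)) := by ring
      _ ≤ 17 ^ (200 * m) * 17 ^ (200 * m) :=
          Nat.mul_le_mul (choose_mul_pow_le _ _) (Nat.div_mul_le_self _ _)
      _ = (17 ^ 20) ^ (20 * m) := by rw [← pow_add, ← pow_mul]; congr 1; ring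
      _ ≤ (2 ^ 84) ^ (20 * m) := Nat.pow_le_pow_left (by norm_num) _
      _ ≤ 2 ^ (118 * m + 4 * (196 * m) + 4 * (196 * m)) := by
          rw [← pow_mul]; exact Nat.pow_le_pow_right (by norm_num) (by omega)
      _ = _ := by rw [pow_add, pow_add, pow_mul 2 4]; ring
  obtain ⟨C, hC, hcard⟩ := exists_conflict_free r
    (fun x => ⟨(List.ofFn x).take (196 * m), List.take_sublist _ _, List.take_sublist _ _, by simp⟩)
    (fun x y ⟨t, h1, h2, h3⟩ => ⟨t, h2, h1, h3⟩) _ hV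
  refine ⟨C, ?_, fun x hx x' hx' t h1 h2 h3 => hC x hx x' hx' ⟨t.take (196 * m),
    (List.take_sublist _ _).trans h1, (List.take_sublist _ _).trans h2, by simp; omega⟩⟩
  have h : Fintype.card (Fin (200 * m) → Bool) = 2 ^ (82 * m) * 2 ^ (118 * m) := by
    rw [← pow_add]; simp; ring
  rw [h] at hcard
  exact Nat.le_of_mul_le_mul_right hcard (by positivity)

/-- The binary block of length `5 * L` representing a symbol: `true` is sent as `0^{4L} 1^L` and
`false` as `0^L 1^{4L}`. -/
def blockWord (L : ℕ) (v : Bool) (j : Fin (5 * L)) : Bool :=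
  if v then decide (4 * L ≤ (j : ℕ)) else decide (L ≤ (j : ℕ))

/-- The concatenation of the blocks representing the symbols of a word. -/
def blockEncode {n : ℕ} (L : ℕ) (x : Fin n → Bool) (k : Fin (n * (5 * L))) : Bool :=
  blockWord L (x (finProdFinEquiv.symm k).1) (finProdFinEquiv.symm k).2

theorem blockEncode_apply {n : ℕ} (L : ℕ) (x : Fin n → Bool) (i : Fin n) (j : Fin (5 * L)) :
    blockEncode L x (finProdFinEquiv (i, j)) = blockWord L (x i) j := by
  simp only [blockEncode, Equiv.symm_apply_apply]

theorem blockEncode_injective {n L : ℕ} (hL : 0 < L) :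
    Function.Injective (blockEncode (n := n) L) := by
  intro x x' h
  funext i
  have := congrFun h (finProdFinEquiv (i, ⟨L, by omega⟩))
  rw [blockEncode_apply, blockEncode_apply] at this
  have h4 : ¬ 4 * L ≤ L := by omega
  cases hx : x i <;> cases hx' : x' i <;> simp_all [blockWord]

theorem received_eq_ofFn {N : ℕ} (c S : Fin N → Bool) :
    received c S = ((List.ofFn fun i => (c i, S i)).filter Prod.snd).map Prod.fst := by
  rw [List.ofFn_eq_map, List.filter_map, List.map_map]
  rfl

theorem received_mul {n B : ℕ} (c S : Fin (n * B) → Bool) :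
    received c S = (List.ofFn fun i : Fin n =>
      received (fun j => c (finProdFinEquiv (i, j)))
        (fun j => S (finProdFinEquiv (i, j)))).flatten := by
  simp only [received_eq_ofFn]
  rw [List.ofFn_mul, List.filter_flatten, List.map_flatten, List.map_ofFn, List.map_ofFn]
  congr 2
  funext i
  simp only [Function.comp_apply]
  congr 3
  funext j
  have : (⟨i * B + j, (Nat.add_lt_add_left j.prop _).trans_le (by
      rw [← Nat.succ_mul]; exact Nat.mul_le_mul_right _ i.prop)⟩ : Fin (n * B)) =
      finProdFinEquiv (i, j) := by
    ext; simp [finProdFinEquiv]; ring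
  simp only [← this]

theorem countP_ofFn {α : Type*} {n : ℕ} (f : Fin n → α) (q : α → Bool) :
    (List.ofFn f).countP q = ∑ i, if q (f i) then 1 else 0 := by
  induction n with
  | zero => simp
  | succ n ih => rw [List.ofFn_succ, List.countP_cons, ih, Fin.sum_univ_succ, add_comm]

theorem count_received {N : ℕ} (c S : Fin N → Bool) (v : Bool) :
    (received c S).count v = ∑ j, if S j = true ∧ c j = v then 1 else 0 := by
  rw [received_eq_ofFn, List.count_eq_countP, List.countP_map, List.countP_filter, countP_ofFn]
  refine Finset.sum_congr rfl fun j _ => ?_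
  simp [and_comm]

theorem eq_replicate_of_pairwise_le {l : List Bool} (h : l.Pairwise (· ≤ ·)) :
    l = List.replicate (l.count false) false ++ List.replicate (l.count true) true := by
  induction l with
  | nil => simp
  | cons a l ih =>
    obtain ⟨h1, h2⟩ := List.pairwise_cons.1 h
    cases a with
    | false =>
      conv_lhs => rw [ih h2]
      simp [List.replicate_succ]
    | true =>
      have hl : ∀ b ∈ l, b = true := fun b hb => Bool.le_iff_imp.1 (h1 b hb) rfl
      rw [List.eq_replicate_of_mem hl]
      simp [List.replicate_succ, List.count_replicate]

theorem received_blockWord (L : ℕ) (v : Bool) (S : Fin (5 * L) → Bool) :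
    received (blockWord L v) S =
      List.replicate ((received (blockWord L v) S).count false) false ++
        List.replicate ((received (blockWord L v) S).count true) true := by
  apply eq_replicate_of_pairwise_le
  rw [received, List.pairwise_map]
  refine (List.Pairwise.sublist List.filter_sublist (List.pairwise_lt_finRange _)).imp ?_
  intro i j hij
  have : (i : ℕ) < j := hij
  cases v <;> simp only [blockWord, Bool.le_iff_imp] <;> simp <;> omega

/-- The penalty of the received version of the block representing `v`, given the keep-pattern. -/
def patternPenalty (L : ℕ) (v : Bool) (S : Fin (5 * L) → Bool) : ℕ :=
  blockPenalty v ((received (blockWord L v) S).count false)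
    ((received (blockWord L v) S).count true)

theorem exists_common_sublist_received {n : ℕ} (L : ℕ) (x : Fin n → Bool)
    (S : Fin (n * (5 * L)) → Bool) :
    ∃ s : List Bool, s.Sublist (List.ofFn x) ∧
      s.Sublist (chunkDecode (received (blockEncode L x) S)) ∧
      n ≤ s.length + 2 * ∑ i, patternPenalty L (x i) (fun j => S (finProdFinEquiv (i, j))) ∧
      (chunkDecode (received (blockEncode L x) S)).length ≤ n := by
  obtain ⟨s, h1, h2, h3, h4⟩ := exists_common_sublist_chunkDecode (List.ofFn fun i : Fin n =>
    (x i, (received (blockWord L (x i)) fun j => S (finProdFinEquiv (i, j))).count false,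
      (received (blockWord L (x i)) fun j => S (finProdFinEquiv (i, j))).count true))
  simp only [List.map_ofFn, Function.comp_def, List.length_ofFn, ← received_blockWord,
    List.sum_ofFn] at h1 h2 h3 h4
  have hr : received (blockEncode L x) S = (List.ofFn fun i : Fin n =>
      received (blockWord L (x i)) fun j => S (finProdFinEquiv (i, j))).flatten := by
    rw [received_mul]
    simp only [blockEncode_apply]
  rw [hr]
  exact ⟨s, h1, h2, (Nat.le_add_right _ _).trans h3, h4⟩

theorem prod_blockWord (L : ℕ) (v : Bool) (a b : ℝ) :
    ∏ j : Fin (5 * L), (if blockWord L v j = v then a else b) = a ^ L * b ^ (4 * L) := by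
  cases v with
  | false =>
    have : ∀ j : Fin (5 * L), (if blockWord L false j = false then a else b) =
        (fun k : ℕ => if k < L then a else b) j := fun j => by simp [blockWord]
    rw [Finset.prod_congr rfl fun j _ => this j,
      Fin.prod_univ_eq_prod_range (fun k : ℕ => if k < L then a else b),
      show 5 * L = L + 4 * L by ring, Finset.prod_range_add]
    congr 1
    · rw [Finset.prod_congr rfl fun k hk => if_pos (Finset.mem_range.1 hk)]; simp
    · simp
  | true =>
    have : ∀ j : Fin (5 * L), (if blockWord L true j = true then a else b) =
        (fun k : ℕ => if 4 * L ≤ k then a else b) j := fun j => by simp [blockWord]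
    rw [Finset.prod_congr rfl fun j _ => this j,
      Fin.prod_univ_eq_prod_range (fun k : ℕ => if 4 * L ≤ k then a else b),
      show 5 * L = 4 * L + L by ring, Finset.prod_range_add, mul_comm]
    congr 1
    · simp
    · rw [Finset.prod_congr rfl fun k hk => if_neg (not_le.2 (Finset.mem_range.1 hk))]; simp

theorem sum_prod_apply {ι κ : Type*} [Fintype ι] [DecidableEq ι] [Fintype κ] (f : ι → κ → ℝ) :
    ∑ S : ι → κ, ∏ i, f i (S i) = ∏ i, ∑ b, f i b := by
  rw [Finset.prod_univ_sum, Fintype.piFinset_univ]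

/-- The probability that a bit is kept, resp. deleted, by the channel. -/
def keepWeight (p : ℝ) (b : Bool) : ℝ := if b then 1 - p else p

theorem keepWeight_nonneg {p : ℝ} (h0 : 0 ≤ p) (h1 : p ≤ 1) (b : Bool) : 0 ≤ keepWeight p b := by
  unfold keepWeight; split_ifs <;> linarith

theorem sum_keepWeight (p : ℝ) (N : ℕ) :
    ∑ S : Fin N → Bool, ∏ i, keepWeight p (S i) = 1 := by
  rw [sum_prod_apply fun _ => keepWeight p]
  simp [keepWeight]

theorem pow_patternPenalty_le (L : ℕ) (v : Bool) (S : Fin (5 * L) → Bool) :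
    (5 : ℝ) ^ patternPenalty L v S ≤ 1 + 4 * (
      ∏ j, (if S j = true ∧ blockWord L v j = v then (0 : ℝ) else 1) +
      ∏ j, ((2 : ℝ) ^ (if S j = true ∧ blockWord L v j = v then 1 else 0) *
        (1 / 2) ^ (if S j = true ∧ blockWord L v j = !v then 1 else 0))) := by
  have hg : (0 : ℝ) ≤ ∏ j, (if S j = true ∧ blockWord L v j = v then (0 : ℝ) else 1) :=
    Finset.prod_nonneg fun j _ => by split_ifs <;> norm_num
  rw [Finset.prod_mul_distrib, Finset.prod_pow_eq_pow_sum, Finset.prod_pow_eq_pow_sum,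
    ← count_received, ← count_received]
  have hpen : patternPenalty L v S =
      if 0 < (received (blockWord L v) S).count v ∧ (received (blockWord L v) S).count v <
        (received (blockWord L v) S).count (!v) then 0 else 1 := by
    cases v <;> rfl
  rw [hpen]
  have hh : (0 : ℝ) ≤ 2 ^ (received (blockWord L v) S).count v *
      (1 / 2) ^ (received (blockWord L v) S).count (!v) := by positivity
  split_ifs with h
  · rw [pow_zero]; linarith
  · rw [pow_one]
    rcases Nat.eq_zero_or_pos ((received (blockWord L v) S).count v) with h0 | h0
    · rw [count_received, Finset.sum_eq_zero_iff] at h0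
      have : ∏ j, (if S j = true ∧ blockWord L v j = v then (0 : ℝ) else 1) = 1 :=
        Finset.prod_eq_one fun j hj => if_neg fun hc => by simpa [hc] using h0 j hj
      linarith
    · have hle : (received (blockWord L v) S).count (!v) ≤
          (received (blockWord L v) S).count v := by
        by_contra hlt
        exact h ⟨h0, by omega⟩
      have : (1 : ℝ) ≤ 2 ^ (received (blockWord L v) S).count v *
          (1 / 2) ^ (received (blockWord L v) S).count (!v) := by
        rw [one_div, inv_pow, ← div_eq_mul_inv, one_le_div (by positivity)]
        exact pow_le_pow_right₀ (by norm_num) hle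
      linarith

theorem sum_pow_patternPenalty_le {p : ℝ} (hp : p ∈ Set.Ioo (0 : ℝ) 1) {L : ℕ}
    (hL : 8 ≤ (1 - p) * L) (v : Bool) :
    ∑ S : Fin (5 * L) → Bool, (∏ j, keepWeight p (S j)) * (5 : ℝ) ^ patternPenalty L v S ≤
      1004 / 1000 := by
  obtain ⟨h0, h1⟩ := hp
  have hsum := Finset.sum_le_sum fun (S : Fin (5 * L) → Bool) (_ : S ∈ Finset.univ) =>
    mul_le_mul_of_nonneg_left (pow_patternPenalty_le L v S)
      (Finset.prod_nonneg fun j (_ : j ∈ Finset.univ) => keepWeight_nonneg h0.le h1.le (S j))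
  refine hsum.trans ?_
  simp only [mul_add, mul_one, mul_left_comm _ (4 : ℝ), Finset.sum_add_distrib, ← Finset.mul_sum,
    ← Finset.prod_mul_distrib, sum_keepWeight]
  rw [sum_prod_apply fun (j : Fin (5 * L)) b =>
      keepWeight p b * if b = true ∧ blockWord L v j = v then (0 : ℝ) else 1,
    sum_prod_apply fun (j : Fin (5 * L)) b => keepWeight p b *
      ((2 : ℝ) ^ (if b = true ∧ blockWord L v j = v then 1 else 0) *
        (1 / 2) ^ (if b = true ∧ blockWord L v j = !v then 1 else 0))]
  have hg : ∀ j : Fin (5 * L), (∑ b, keepWeight p b *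
      if b = true ∧ blockWord L v j = v then (0 : ℝ) else 1) =
        if blockWord L v j = v then p else 1 := fun j => by
    by_cases hj : blockWord L v j = v <;> simp [keepWeight, hj]
  have hh : ∀ j : Fin (5 * L), (∑ b, keepWeight p b *
      ((2 : ℝ) ^ (if b = true ∧ blockWord L v j = v then 1 else 0) *
        (1 / 2) ^ (if b = true ∧ blockWord L v j = !v then 1 else 0))) =
        if blockWord L v j = v then 1 + (1 - p) else 1 - (1 - p) / 2 := fun j => by
    by_cases hj : blockWord L v j = v
    · simp [keepWeight, hj]; ring
    · have hj' : blockWord L v j = !v := by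
        cases hb : blockWord L v j <;> cases v <;> simp_all
      simp [keepWeight, hj']; ring
  rw [Finset.prod_congr rfl fun j _ => hg j, Finset.prod_congr rfl fun j _ => hh j,
    prod_blockWord, prod_blockWord, one_pow, mul_one]
  have hexp : Real.exp (-((1 - p) * L)) ≤ 1 / 2000 := by
    have h8 : (2000 : ℝ) ≤ Real.exp ((1 - p) * L) := by
      have he : Real.exp 8 = Real.exp 1 ^ 8 := by rw [← Real.exp_nat_mul]; norm_num
      calc (2000 : ℝ) ≤ 2.7 ^ 8 := by norm_num
        _ ≤ Real.exp 1 ^ 8 := by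
          gcongr
          exact (by norm_num : (2.7 : ℝ) ≤ 2.7182818283).trans Real.exp_one_gt_d9.le
        _ ≤ _ := he ▸ Real.exp_le_exp.2 hL
    rw [Real.exp_neg, inv_eq_one_div]
    exact one_div_le_one_div_of_le (by norm_num) h8
  have hA : p ^ L ≤ Real.exp (-((1 - p) * L)) := by
    have := Real.add_one_le_exp (-(1 - p))
    calc p ^ L ≤ Real.exp (-(1 - p)) ^ L := by gcongr; linarith
      _ = _ := by rw [← Real.exp_nat_mul]; ring_nf
  have hB : (1 + (1 - p)) ^ L * (1 - (1 - p) / 2) ^ (4 * L) ≤ Real.exp (-((1 - p) * L)) := by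
    have h2 := Real.add_one_le_exp (1 - p)
    have h3 := Real.add_one_le_exp (-((1 - p) / 2))
    calc _ ≤ Real.exp (1 - p) ^ L * Real.exp (-((1 - p) / 2)) ^ (4 * L) := by
          have h4 : 0 ≤ 1 - (1 - p) / 2 := by linarith
          gcongr <;> linarith
      _ = _ := by
          rw [← Real.exp_nat_mul, ← Real.exp_nat_mul, ← Real.exp_add]
          push_cast
          ring_nf
  linarith

theorem sum_pow_total_patternPenalty_le {p : ℝ} (hp : p ∈ Set.Ioo (0 : ℝ) 1) {n L : ℕ}
    (hL : 8 ≤ (1 - p) * L) (x : Fin n → Bool) :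
    ∑ S : Fin (n * (5 * L)) → Bool, (∏ k, keepWeight p (S k)) *
      (5 : ℝ) ^ ∑ i, patternPenalty L (x i) (fun j => S (finProdFinEquiv (i, j))) ≤
        (1004 / 1000) ^ n := by
  let e : (Fin (n * (5 * L)) → Bool) ≃ (Fin n → Fin (5 * L) → Bool) :=
    (Equiv.arrowCongr finProdFinEquiv.symm (Equiv.refl Bool)).trans (Equiv.curry _ _ _)
  have hterm : ∀ S : Fin (n * (5 * L)) → Bool, (∏ k, keepWeight p (S k)) *
      (5 : ℝ) ^ ∑ i, patternPenalty L (x i) (fun j => S (finProdFinEquiv (i, j))) =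
      ∏ i, ((∏ j, keepWeight p (e S i j)) * (5 : ℝ) ^ patternPenalty L (x i) (e S i)) := by
    intro S
    rw [Finset.prod_mul_distrib, Finset.prod_pow_eq_pow_sum, ← finProdFinEquiv.prod_comp,
      Fintype.prod_prod_type]
    rfl
  rw [Finset.sum_congr rfl fun S _ => hterm S, e.sum_comp (fun T => ∏ i,
    ((∏ j, keepWeight p (T i j)) * (5 : ℝ) ^ patternPenalty L (x i) (T i))),
    sum_prod_apply fun i (T : Fin (5 * L) → Bool) =>
      (∏ j, keepWeight p (T j)) * (5 : ℝ) ^ patternPenalty L (x i) T]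
  calc _ ≤ ∏ _i : Fin n, (1004 / 1000 : ℝ) := by
        refine Finset.prod_le_prod (fun i _ => Finset.sum_nonneg fun T _ => mul_nonneg
          (Finset.prod_nonneg fun j _ => keepWeight_nonneg hp.1.le hp.2.le _) (by positivity))
          fun i _ => sum_pow_patternPenalty_le hp hL (x i)
    _ = _ := by rw [Finset.prod_const, Finset.card_univ, Fintype.card_fin]

/-- For every deletion probability `p ∈ (0,1)` and every `ε > 0`, there are arbitrarily
large block lengths `N` admitting a code `C ⊆ {0,1}^N` of size at least `2^((1-p)N/110)`
and a decoder `Dec` such that every codeword, sent through the binary deletion channel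
with deletion probability `p` (each bit kept independently with probability `1-p`),
is decoded correctly with probability at least `1 - ε`. -/
theorem bdc_capacity_lower_bound (p : ℝ) (hp : p ∈ Set.Ioo (0 : ℝ) 1) (ε : ℝ) (hε : 0 < ε) :
    ∀ N₀ : ℕ, ∃ N : ℕ, N₀ ≤ N ∧
      ∃ (C : Finset (Fin N → Bool)) (Dec : List Bool → (Fin N → Bool)),
        (C.card : ℝ) ≥ 2 ^ ((1 - p) * N / 110) ∧
        ∀ c ∈ C,
          (∑ S : Fin N → Bool,
              (∏ i : Fin N, if S i then (1 - p) else p) *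
                (if Dec (received c S) = c then (1 : ℝ) else 0)) ≥ 1 - ε := by
  classical
  intro N₀
  have hq : 0 < 1 - p := sub_pos.2 hp.2
  obtain ⟨m₁, hm₁⟩ := exists_pow_lt_of_lt_one hε (by norm_num : (1 / 2 : ℝ) < 1)
  set m := max N₀ m₁ with hm
  set L := ⌈8 / (1 - p)⌉₊
  have hL8 : 8 ≤ (1 - p) * L := by
    have := Nat.le_ceil (8 / (1 - p))
    rwa [div_le_iff₀ hq, mul_comm] at this
  have hL9 : (1 - p) * L ≤ 9 := by
    have := (Nat.ceil_lt_add_one (by positivity : 0 ≤ 8 / (1 - p))).le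
    calc (1 - p) * L ≤ (1 - p) * (8 / (1 - p) + 1) := by gcongr
      _ = 8 + (1 - p) := by field_simp
      _ ≤ 9 := by linarith [hp.1]
  have hLpos : 0 < L := Nat.ceil_pos.2 (by positivity)
  obtain ⟨C, hcard, hC⟩ := exists_code_common_sublist m
  let compatible (x : Fin (200 * m) → Bool) (y : List Bool) : Prop :=
    ∃ s : List Bool, s.Sublist (List.ofFn x) ∧ s.Sublist (chunkDecode y) ∧
      198 * m ≤ s.length ∧ (chunkDecode y).length ≤ 200 * m
  have hunique : ∀ x ∈ C, ∀ x' ∈ C, ∀ y, compatible x y → compatible x' y → x = x' := by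
    rintro x hx x' hx' y ⟨s, hs1, hs2, hs3, hs4⟩ ⟨s', hs1', hs2', hs3', -⟩
    obtain ⟨t, ht1, ht2, ht3⟩ := exists_common_sublist_of_sublist hs2 hs2'
    exact hC x hx x' hx' t (ht1.trans hs1) (ht2.trans hs1') (by omega)
  refine ⟨200 * m * (5 * L), ?_, C.image (blockEncode L), fun y =>
    if h : ∃ x ∈ C, compatible x y then blockEncode L h.choose else fun _ => false, ?_, ?_⟩
  · have : m * 1 ≤ m * (200 * (5 * L)) := Nat.mul_le_mul_left _ (by omega)
    calc N₀ ≤ m * 1 := by simp [hm]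
      _ ≤ _ := this
      _ = _ := by ring
  · rw [Finset.card_image_of_injective _ (blockEncode_injective hLpos), ge_iff_le]
    calc (2 : ℝ) ^ ((1 - p) * (200 * m * (5 * L) : ℕ) / 110) ≤ (2 : ℝ) ^ ((82 * m : ℕ) : ℝ) := by
          refine Real.rpow_le_rpow_of_exponent_le (by norm_num) ?_
          push_cast
          have := mul_le_mul_of_nonneg_right hL9 (Nat.cast_nonneg m : (0 : ℝ) ≤ m)
          have hm0 : (0 : ℝ) ≤ m := Nat.cast_nonneg m
          linarith
      _ = ((2 ^ (82 * m) : ℕ) : ℝ) := by rw [Real.rpow_natCast]; push_cast; rfl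
      _ ≤ _ := by exact_mod_cast hcard
  · intro c hc
    obtain ⟨x, hx, rfl⟩ := Finset.mem_image.1 hc
    have hdec : ∀ S : Fin (200 * m * (5 * L)) → Bool,
        1 - (5 : ℝ) ^ (∑ i, patternPenalty L (x i) (fun j => S (finProdFinEquiv (i, j)))) / 5 ^ m ≤
          if (if h : ∃ x' ∈ C, compatible x' (received (blockEncode L x) S) then
            blockEncode L h.choose else fun _ => false) = blockEncode L x then (1 : ℝ) else 0 := by
      intro S
      by_cases hle : ∑ i, patternPenalty L (x i) (fun j => S (finProdFinEquiv (i, j))) ≤ m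
      · obtain ⟨s, h1, h2, h3, h4⟩ := exists_common_sublist_received L x S
        have hcomp : compatible x (received (blockEncode L x) S) := ⟨s, h1, h2, by omega, h4⟩
        have hex : ∃ x' ∈ C, compatible x' (received (blockEncode L x) S) := ⟨x, hx, hcomp⟩
        rw [dif_pos hex, hunique _ hex.choose_spec.1 x hx _ hex.choose_spec.2 hcomp, if_pos rfl]
        have : (0 : ℝ) ≤ (5 : ℝ) ^ (∑ i, patternPenalty L (x i)
          (fun j => S (finProdFinEquiv (i, j)))) / 5 ^ m := by positivity
        linarith
      · have : (1 : ℝ) ≤ (5 : ℝ) ^ (∑ i, patternPenalty L (x i)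
            (fun j => S (finProdFinEquiv (i, j)))) / 5 ^ m := by
          rw [one_le_div (by positivity)]
          exact pow_le_pow_right₀ (by norm_num) (not_le.1 hle).le
        refine (sub_nonpos.2 this).trans ?_
        split_ifs <;> norm_num
    have hfail : (1004 / 1000 : ℝ) ^ (200 * m) / 5 ^ m ≤ ε := by
      calc (1004 / 1000 : ℝ) ^ (200 * m) / 5 ^ m = ((1004 / 1000) ^ 200 / 5) ^ m := by
            rw [div_pow _ (5 : ℝ), pow_mul]
        _ ≤ (1 / 2) ^ m := pow_le_pow_left₀ (by norm_num) (by norm_num) m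
        _ ≤ (1 / 2) ^ m₁ := pow_le_pow_of_le_one (by norm_num) (by norm_num) (le_max_right _ _)
        _ ≤ ε := hm₁.le
    have htail := div_le_div_of_nonneg_right
      (sum_pow_total_patternPenalty_le hp hL8 x) (by positivity : (0 : ℝ) ≤ 5 ^ m)
    calc 1 - ε ≤ ∑ S : Fin (200 * m * (5 * L)) → Bool, (∏ k, keepWeight p (S k)) *
          (1 - (5 : ℝ) ^ (∑ i, patternPenalty L (x i)
            (fun j => S (finProdFinEquiv (i, j)))) / 5 ^ m) := by
          simp only [mul_sub, mul_one, Finset.sum_sub_distrib, sum_keepWeight, ← mul_div_assoc,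
            ← Finset.sum_div]
          linarith
      _ ≤ _ := Finset.sum_le_sum fun S _ => mul_le_mul_of_nonneg_left (hdec S)
          (Finset.prod_nonneg fun j _ => keepWeight_nonneg hp.1.le hp.2.le _)
end

section
/- Let m be a positive integer, let t be an integer with 1 ≤ t < m/2, and let c ∈ {0,1}^m. Then the number of strings c' ∈ {0,1}^m such that c and c' are confusable under t deletions, i.e., such that c and c' have a common subsequence of length at least m − t, is at most t·C(m, m − t)², where C(·,·) denotes the binomial coefficient. -/
open Finset in
theorem sum_range_choose_succ (n d : ℕ) :
    ∑ i ∈ range (d + 1), (n + 1).choose i =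
      ∑ i ∈ range (d + 1), n.choose i + ∑ i ∈ range d, n.choose i := by
  rw [sum_range_succ' _ d, sum_range_succ' (fun i => n.choose i) d]
  simp only [Nat.choose_succ_succ', sum_add_distrib, Nat.choose_zero_right]
  omega

/-- The binary words of length `n` having `w` as a subsequence. -/
noncomputable def supersequences (w : List Bool) (n : ℕ) : Finset (List Bool) :=
  (List.finite_length_eq Bool n).toFinset.filter (w.Sublist ·)

theorem mem_supersequences {w l : List Bool} {n : ℕ} :
    l ∈ supersequences w n ↔ l.length = n ∧ w.Sublist l := by
  simp [supersequences]

theorem supersequences_nil_succ_subset (n : ℕ) :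
    supersequences [] (n + 1) ⊆
      (supersequences [] n).image (List.cons true) ∪
        (supersequences [] n).image (List.cons false) := by
  intro l hl
  rw [mem_supersequences] at hl
  obtain ⟨hl, -⟩ := hl
  match l, hl with
  | x :: l', hl =>
    cases x <;> simpa [mem_supersequences] using hl

theorem supersequences_cons_succ_subset (a : Bool) (w : List Bool) (n : ℕ) :
    supersequences (a :: w) (n + 1) ⊆
      (supersequences w n).image (List.cons a) ∪
        (supersequences (a :: w) n).image (List.cons (!a)) := by
  intro l hl
  rw [mem_supersequences] at hl
  obtain ⟨hl, hs⟩ := hl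
  match l, hl, hs with
  | x :: l', hl, hs =>
    have hl' : l'.length = n := by simpa using hl
    by_cases hx : x = a
    · subst hx
      exact Finset.mem_union_left _ (Finset.mem_image_of_mem _
        (mem_supersequences.2 ⟨hl', List.cons_sublist_cons.1 hs⟩))
    · obtain rfl : x = !a := by cases x <;> cases a <;> simp_all
      refine Finset.mem_union_right _ (Finset.mem_image_of_mem _
        (mem_supersequences.2 ⟨hl', ?_⟩))
      rcases List.sublist_cons_iff.1 hs with h | ⟨r, hr, -⟩
      · exact h
      · exact absurd (List.cons.inj hr).1.symm hx

theorem card_supersequences_le (n : ℕ) (w : List Bool) :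
    (supersequences w n).card ≤ ∑ i ∈ Finset.range (n + 1 - w.length), n.choose i := by
  induction n generalizing w with
  | zero =>
    cases w with
    | nil =>
      calc (supersequences [] 0).card ≤ ({[]} : Finset (List Bool)).card :=
            Finset.card_le_card fun l hl => by simpa [mem_supersequences] using hl
        _ ≤ _ := by simp
    | cons a w =>
      have : supersequences (a :: w) 0 = ∅ := by
        ext l
        simp only [mem_supersequences, Finset.notMem_empty, iff_false, not_and]
        intro h hs
        have := hs.length_le
        simp at this
        omega
      simp [this]
  | succ n ih =>
    cases w with
    | nil =>
      have h := (Finset.card_le_card (supersequences_nil_succ_subset n)).trans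
        (Finset.card_union_le _ _)
      have h₁ := Finset.card_image_le (s := supersequences [] n) (f := List.cons true)
      have h₂ := Finset.card_image_le (s := supersequences [] n) (f := List.cons false)
      have h₃ := ih []
      simp only [List.length_nil, Nat.sub_zero, Nat.sum_range_choose] at h₃ ⊢
      rw [pow_succ]
      omega
    | cons a w =>
      have h := (Finset.card_le_card (supersequences_cons_succ_subset a w n)).trans
        (Finset.card_union_le _ _)
      have h₁ := Finset.card_image_le (s := supersequences w n) (f := List.cons a)
      have h₂ := Finset.card_image_le (s := supersequences (a :: w) n) (f := List.cons (!a))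
      have h₃ := ih w
      have h₄ := ih (a :: w)
      simp only [List.length_cons] at h₄ ⊢
      rcases Nat.lt_or_ge n w.length with hw | hw
      · rw [show n + 1 - w.length = 0 by omega] at h₃
        rw [show n + 1 - (w.length + 1) = 0 by omega] at h₄
        simp only [Finset.range_zero, Finset.sum_empty] at h₃ h₄
        omega
      · obtain ⟨d, rfl⟩ := Nat.exists_eq_add_of_le hw
        rw [show w.length + d + 1 - w.length = d + 1 by omega] at h₃
        rw [show w.length + d + 1 - (w.length + 1) = d by omega] at h₄
        rw [show w.length + d + 1 + 1 - (w.length + 1) = d + 1 by omega,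
          sum_range_choose_succ]
        omega

theorem sum_range_choose_le_mul_choose {m t : ℕ} (ht : 2 ≤ t) (htm : 2 * t < m) :
    ∑ i ∈ Finset.range (t + 1), m.choose i ≤ t * m.choose t := by
  induction t, ht using Nat.le_induction with
  | base =>
    obtain ⟨k, rfl⟩ := Nat.exists_eq_add_of_lt htm
    have h : (2 * 2 + k + 1).choose 2 * 2 = (2 * 2 + k + 1) * (2 * 2 + k) := by
      simpa using (Nat.add_one_mul_choose_eq (2 * 2 + k) 1).symm
    simp only [Finset.sum_range_succ, Finset.range_zero, Finset.sum_empty,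
      Nat.choose_zero_right, Nat.choose_one_right]
    nlinarith
  | succ t ht ih =>
    have h := ih (by omega)
    have hle : m.choose t ≤ m.choose (t + 1) := Nat.choose_le_succ_of_lt_half_left (by omega)
    rw [Finset.sum_range_succ, add_mul, one_mul]
    exact Nat.add_le_add_right (h.trans (Nat.mul_le_mul_left t hle)) _

/-- The words of length `m` sharing with `c` a subsequence of length `k`. -/
noncomputable def confusableWords (c : List Bool) (k m : ℕ) : Finset (List Bool) :=
  (c.sublistsLen k).toFinset.biUnion fun w => supersequences w m

theorem mem_confusableWords {c l : List Bool} {k m : ℕ} :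
    l ∈ confusableWords c k m ↔
      ∃ w : List Bool, w.Sublist c ∧ w.length = k ∧ l.length = m ∧ w.Sublist l := by
  simp [confusableWords, mem_supersequences, List.mem_sublistsLen, and_assoc]

theorem card_confusableWords_le (c : List Bool) (k m : ℕ) :
    (confusableWords c k m).card ≤
      c.length.choose k * ∑ i ∈ Finset.range (m + 1 - k), m.choose i := by
  refine (Finset.card_biUnion_le_card_mul _ _ _ fun w hw => ?_).trans
    (Nat.mul_le_mul_right _ ((List.toFinset_card_le _).trans_eq (List.length_sublistsLen _ _)))
  rw [List.mem_toFinset, List.mem_sublistsLen] at hw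
  rw [← hw.2]
  exact card_supersequences_le m w

theorem card_supersequences_succ_le {w : List Bool} {n : ℕ} (hw : w.length = n) :
    (supersequences w (n + 1)).card ≤ n + 2 := by
  refine (card_supersequences_le _ _).trans_eq ?_
  rw [hw, show n + 1 + 1 - n = 2 by omega]
  simp [Finset.sum_range_succ]
  omega

theorem card_supersequences_union_le (a b : Bool) (r : List Bool) :
    (supersequences (b :: r) (r.length + 2) ∪ supersequences (a :: r) (r.length + 2)).card ≤
      2 * (r.length + 2) := by
  have h (x : Bool) : (supersequences (x :: r) (r.length + 2)).card ≤ r.length + 3 :=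
    card_supersequences_succ_le (by simp)
  by_cases hab : a = b
  · subst hab
    rw [Finset.union_self]
    exact (h a).trans (by omega)
  · have hsub : ({a :: b :: r, b :: a :: r} : Finset (List Bool)) ⊆
        supersequences (b :: r) (r.length + 2) ∩ supersequences (a :: r) (r.length + 2) := by
      intro l hl
      simp only [Finset.mem_insert, Finset.mem_singleton] at hl
      rcases hl with rfl | rfl <;> simp [mem_supersequences]
    have h₁ := Finset.card_le_card hsub
    rw [Finset.card_pair (by simp [hab])] at h₁
    have h₂ := Finset.card_union_add_card_inter (supersequences (b :: r) (r.length + 2))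
      (supersequences (a :: r) (r.length + 2))
    have := h a
    have := h b
    omega

theorem confusableWords_subset (a b : Bool) (r : List Bool) (hr : r ≠ []) :
    confusableWords (a :: b :: r) (r.length + 1) (r.length + 2) ⊆
      (supersequences (b :: r) (r.length + 2) ∪ supersequences (a :: r) (r.length + 2)) ∪
        (r.sublistsLen (r.length - 1)).toFinset.biUnion fun w =>
          (supersequences (a :: b :: w) (r.length + 2)).erase (a :: b :: r) := by
  intro l hl
  obtain ⟨w, hwc, hw, hl, hwl⟩ := mem_confusableWords.1 hl
  by_cases hlc : l = a :: b :: r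
  · subst hlc
    simp [mem_supersequences]
  have hpos := List.length_pos_of_ne_nil hr
  cases hwc with
  | cons _ h =>
    obtain rfl := h.eq_of_length (by simp [hw])
    simp [mem_supersequences, hl, hwl]
  | cons_cons _ h =>
    cases h with
    | cons _ h =>
      obtain rfl := h.eq_of_length (by simpa using hw)
      simp [mem_supersequences, hl, hwl]
    | @cons_cons w' _ _ h =>
      refine Finset.mem_union_right _ (Finset.mem_biUnion.2 ⟨w', ?_, ?_⟩)
      · rw [List.mem_toFinset, List.mem_sublistsLen]
        simp only [List.length_cons] at hw
        exact ⟨h, by omega⟩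
      · exact Finset.mem_erase.2 ⟨hlc, mem_supersequences.2 ⟨hl, hwl⟩⟩

theorem card_confusableWords_one_deletion_le (c : List Bool) {n : ℕ} (hn : 2 ≤ n)
    (hc : c.length = n + 1) : (confusableWords c n (n + 1)).card ≤ (n + 1) ^ 2 := by
  match c, hc with
  | [], hc => simp at hc
  | [_], hc =>
    simp at hc
    omega
  | a :: b :: r, hc =>
    obtain rfl : n = r.length + 1 := by simpa using hc.symm
    have hr : r ≠ [] := by
      rintro rfl
      simp at hn
    have hpos := List.length_pos_of_ne_nil hr
    have hcard : (r.sublistsLen (r.length - 1)).toFinset.card ≤ r.length := by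
      refine (List.toFinset_card_le _).trans_eq ?_
      rw [List.length_sublistsLen, Nat.choose_symm hpos, Nat.choose_one_right]
    have hrest := Finset.card_biUnion_le_card_mul (r.sublistsLen (r.length - 1)).toFinset
      (fun w => (supersequences (a :: b :: w) (r.length + 2)).erase (a :: b :: r))
      (r.length + 2) (fun w hw => by
        rw [List.mem_toFinset, List.mem_sublistsLen] at hw
        rw [Finset.card_erase_of_mem (mem_supersequences.2 ⟨by simp, by simpa using hw.1⟩)]
        have : (supersequences (a :: b :: w) (r.length + 2)).card ≤ r.length + 3 :=
          card_supersequences_succ_le (by simp only [List.length_cons]; omega)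
        omega)
    have hfirst := card_supersequences_union_le a b r
    have h := (Finset.card_le_card (confusableWords_subset a b r hr)).trans
      (Finset.card_union_le _ _)
    have := Nat.mul_le_mul_right (r.length + 2) hcard
    nlinarith

/-- Paper's Lemma 3.1 (with `t = δm`, `0 < δ < 1/2`): for any binary string `c` of
length `m`, the number of binary strings `c'` of length `m` that are confusable with `c`
under `t` deletions — i.e., that share with `c` a common subsequence of length at least
`m - t` — is at most `t · C(m, m-t)²`. -/
theorem confusable_count_bound (m t : ℕ) (ht : 1 ≤ t) (htm : 2 * t < m)
    (c : List Bool) (hc : c.length = m) :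
    {c' : List Bool | c'.length = m ∧
        ∃ w : List Bool, m - t ≤ w.length ∧ w.Sublist c ∧ w.Sublist c'}.ncard ≤
      t * (m.choose (m - t)) ^ 2 := by
  have hsub : {c' : List Bool | c'.length = m ∧
      ∃ w : List Bool, m - t ≤ w.length ∧ w.Sublist c ∧ w.Sublist c'} ⊆
      (confusableWords c (m - t) m : Set (List Bool)) := by
    rintro l ⟨hl, w, hw, hwc, hwl⟩
    have htake := List.take_sublist (m - t) w
    exact mem_confusableWords.2 ⟨w.take (m - t), htake.trans hwc,
      by rw [List.length_take, min_eq_left hw], hl, htake.trans hwl⟩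
  refine (Set.ncard_le_ncard hsub (Finset.finite_toSet _)).trans ?_
  rw [Set.ncard_coe_finset]
  rcases ht.eq_or_lt with rfl | ht
  · obtain ⟨n, rfl⟩ : ∃ n, m = n + 1 := ⟨m - 1, by omega⟩
    simpa using card_confusableWords_one_deletion_le c (by omega) hc
  · refine (card_confusableWords_le c (m - t) m).trans ?_
    have hsum := sum_range_choose_le_mul_choose ht htm
    rw [hc, show m + 1 - (m - t) = t + 1 by omega, Nat.choose_symm (by omega : t ≤ m)]
    calc m.choose t * ∑ i ∈ Finset.range (t + 1), m.choose i
        ≤ m.choose t * (t * m.choose t) := Nat.mul_le_mul_left _ hsum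
      _ = t * m.choose t ^ 2 := by ring
end

section
/- Let δ be a real number with 0 < δ < 1/2 and let m be a positive integer such that t := δm is a (positive) integer. Then there exists a code C ⊆ {0,1}^m such that: (i) every codeword of C has all runs of length 1 or 2; (ii) no two distinct codewords of C have a common subsequence of length at least m − t (so C corrects a δ fraction of adversarial insertions and deletions); and (iii) |C| ≥ 2·fib(m + 1) / (t·C(m, m − t)² + 1), where C(·,·) denotes the binomial coefficient. -/
/-- A word has all runs of length 1 or 2 iff no symbol occurs three times
consecutively, i.e., no word of the form `[b, b, b]` is an infix. -/
def runsLenOneOrTwo (w : List Bool) : Prop :=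
  ∀ b : Bool, ¬ ([b, b, b] <:+: w)

/-- The words of length `n`, empty or beginning with `b`, all of whose runs have length 1 or 2. -/
def shortRunWords : Bool → ℕ → Finset (List Bool)
  | _, 0 => {[]}
  | b, 1 => {[b]}
  | b, n + 2 => (shortRunWords (!b) (n + 1)).image (b :: ·) ∪
      (shortRunWords (!b) n).image (b :: b :: ·)

lemma length_of_mem_shortRunWords (b : Bool) (n : ℕ) :
    ∀ w ∈ shortRunWords b n, w.length = n := by
  induction b, n using shortRunWords.induct with
  | case1 b => simp [shortRunWords]
  | case2 b => simp [shortRunWords]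
  | case3 b n ih₁ ih₂ =>
    intro w hw
    simp only [shortRunWords, Finset.mem_union, Finset.mem_image] at hw
    rcases hw with ⟨u, hu, rfl⟩ | ⟨u, hu, rfl⟩
    · simp [ih₁ u hu]
    · simp [ih₂ u hu]

lemma head?_of_mem_shortRunWords (b : Bool) (n : ℕ) :
    ∀ w ∈ shortRunWords b n, w.head? ≠ some (!b) := by
  induction b, n using shortRunWords.induct with
  | case1 b => simp [shortRunWords]
  | case2 b => simp [shortRunWords]
  | case3 b n ih₁ ih₂ =>
    intro w hw
    simp only [shortRunWords, Finset.mem_union, Finset.mem_image] at hw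
    rcases hw with ⟨u, hu, rfl⟩ | ⟨u, hu, rfl⟩ <;> simp

lemma runsLenOneOrTwo_cons {b : Bool} {u : List Bool} (hu : runsLenOneOrTwo u)
    (h : ¬ [b, b] <+: u) : runsLenOneOrTwo (b :: u) := by
  intro a ha
  rcases List.infix_cons_iff.mp ha with ha | ha
  · obtain ⟨rfl, hbb⟩ := List.cons_prefix_cons.mp ha
    exact h hbb
  · exact hu a ha

lemma runsLenOneOrTwo_of_mem_shortRunWords (b : Bool) (n : ℕ) :
    ∀ w ∈ shortRunWords b n, runsLenOneOrTwo w := by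
  induction b, n using shortRunWords.induct with
  | case1 b => simp [shortRunWords, runsLenOneOrTwo]
  | case2 b =>
    simp only [shortRunWords, Finset.mem_singleton, forall_eq]
    intro a ha
    simpa using ha.length_le
  | case3 b n ih₁ ih₂ =>
    intro w hw
    simp only [shortRunWords, Finset.mem_union, Finset.mem_image] at hw
    have key : ∀ k, ∀ u ∈ shortRunWords (!b) k, ∀ l, ¬ (b :: l) <+: u := by
      rintro k u hu l ⟨v, rfl⟩
      exact head?_of_mem_shortRunWords _ _ _ hu (by simp)
    rcases hw with ⟨u, hu, rfl⟩ | ⟨u, hu, rfl⟩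
    · exact runsLenOneOrTwo_cons (ih₁ u hu) (key _ u hu _)
    · refine runsLenOneOrTwo_cons (runsLenOneOrTwo_cons (ih₂ u hu) (key _ u hu _)) fun h ↦ ?_
      exact key _ u hu _ (List.cons_prefix_cons.mp h).2

lemma card_shortRunWords (b : Bool) (n : ℕ) :
    (shortRunWords b n).card = Nat.fib (n + 1) := by
  induction b, n using shortRunWords.induct with
  | case1 b => simp [shortRunWords]
  | case2 b => simp [shortRunWords]
  | case3 b n ih₁ ih₂ =>
    rw [shortRunWords, Finset.card_union_of_disjoint, Finset.card_image_of_injective,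
      Finset.card_image_of_injective, ih₁, ih₂, Nat.fib_add_two (n := n + 1), add_comm]
    · intro u v h
      simpa using h
    · intro u v h
      simpa using h
    · rw [Finset.disjoint_left]
      simp only [Finset.mem_image, not_exists, not_and]
      rintro _ ⟨u, hu, rfl⟩ v hv h
      obtain rfl : b :: v = u := by simpa using h
      exact head?_of_mem_shortRunWords _ _ _ hu (by simp)

lemma disjoint_shortRunWords {n : ℕ} (hn : 0 < n) :
    Disjoint (shortRunWords true n) (shortRunWords false n) := by
  rw [Finset.disjoint_left]
  intro w h₁ h₂
  have hlen := length_of_mem_shortRunWords _ _ _ h₁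
  have ht := head?_of_mem_shortRunWords _ _ _ h₁
  have hf := head?_of_mem_shortRunWords _ _ _ h₂
  match w with
  | [] => simp at hlen; omega
  | true :: _ => simp at hf
  | false :: _ => simp at ht

/-- At most `∑ i ≤ m - |w|, C(m, i)` binary words of length `m` contain `w` as a subsequence. -/
lemma exists_finset_supersequences (m : ℕ) (w : List Bool) :
    ∃ F : Finset (List Bool), (∀ v : List Bool, v.length = m → w.Sublist v → v ∈ F) ∧
      F.card ≤ ∑ i ∈ Finset.range (m + 1 - w.length), m.choose i := by
  induction m generalizing w with
  | zero =>
    cases w with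
    | nil => exact ⟨{[]}, by simp, by simp⟩
    | cons a w =>
      refine ⟨∅, fun v hv h ↦ ?_, by simp⟩
      simpa [hv] using h.length_le
  | succ m ih =>
    cases w with
    | nil =>
      obtain ⟨F, hF, hcard⟩ := ih []
      refine ⟨F.image (true :: ·) ∪ F.image (false :: ·), fun v hv _ ↦ ?_, ?_⟩
      · match v with
        | true :: v => simpa using hF v (by simpa using hv) (List.nil_sublist v)
        | false :: v => simpa using hF v (by simpa using hv) (List.nil_sublist v)
      · refine (Finset.card_union_le _ _).trans ((add_le_add Finset.card_image_le
          Finset.card_image_le).trans ?_)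
        simp only [List.length_nil, Nat.sub_zero, Nat.sum_range_choose] at hcard ⊢
        rw [pow_succ]
        omega
    | cons a w =>
      obtain ⟨F, hF, hFcard⟩ := ih w
      obtain ⟨G, hG, hGcard⟩ := ih (a :: w)
      refine ⟨F.image (a :: ·) ∪ G.image ((!a) :: ·), fun v hv h ↦ ?_, ?_⟩
      · match v with
        | b :: v =>
          have hv' : v.length = m := by simpa using hv
          by_cases hab : b = a
          · subst hab
            simpa using hF v hv' (List.cons_sublist_cons.mp h)
          · have h' : (a :: w).Sublist v := by
              cases h with
              | cons _ h => exact h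
              | cons_cons _ h => exact absurd rfl hab
            obtain rfl : b = !a := Bool.eq_not.mpr hab
            simpa using hG v hv' h'
      · refine (Finset.card_union_le _ _).trans ((add_le_add
          (Finset.card_image_le.trans hFcard) (Finset.card_image_le.trans hGcard)).trans ?_)
        simp only [List.length_cons, Nat.add_sub_add_right]
        rcases Nat.eq_zero_or_pos (m + 1 - w.length) with h0 | hpos
        · simp [h0, show m - w.length = 0 by omega]
        · obtain ⟨k, hk⟩ := Nat.exists_eq_add_of_lt hpos
          rw [zero_add] at hk
          rw [hk, show m - w.length = k by omega, Finset.sum_range_succ' (m.choose),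
            Finset.sum_range_succ' ((m + 1).choose)]
          simp only [Nat.choose_succ_succ', Finset.sum_add_distrib, Nat.choose_zero_right]
          omega

lemma choose_le_choose_of_le_half {m i t : ℕ} (hit : i ≤ t) (ht : 2 * t ≤ m) :
    m.choose i ≤ m.choose t := by
  induction t, hit using Nat.le_induction with
  | base => exact le_rfl
  | succ t _ ih =>
    exact (ih (by omega)).trans (Nat.choose_le_succ_of_lt_half_left (by omega))

/-- At most `t * C(m, m - t) ^ 2` binary words of length `m` other than `c` share a subsequence
of length at least `m - t` with `c`. -/
lemma exists_finset_confusable {m t : ℕ} (ht : 2 * t ≤ m) {c : List Bool} (hc : c.length = m) :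
    ∃ F : Finset (List Bool),
      (∀ v : List Bool, v.length = m → v ≠ c →
        (∃ w : List Bool, m - t ≤ w.length ∧ w.Sublist c ∧ w.Sublist v) → v ∈ F) ∧
      F.card ≤ t * m.choose (m - t) ^ 2 := by
  choose G hG hGcard using exists_finset_supersequences m
  refine ⟨(c.sublistsLen (m - t)).toFinset.biUnion fun w ↦ (G w).erase c, ?_, ?_⟩
  · rintro v hv hvc ⟨w, hw, hwc, hwv⟩
    have htake := List.take_sublist (m - t) w
    simp only [Finset.mem_biUnion, List.mem_toFinset, List.mem_sublistsLen, Finset.mem_erase]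
    exact ⟨w.take (m - t), ⟨htake.trans hwc, by simpa using hw⟩, hvc,
      hG _ _ hv (htake.trans hwv)⟩
  · have hchoose : m.choose (m - t) = m.choose t := Nat.choose_symm (by omega)
    have hsub : (c.sublistsLen (m - t)).toFinset.card ≤ m.choose t := by
      simpa [hc, hchoose] using List.toFinset_card_le (c.sublistsLen (m - t))
    refine (Finset.card_biUnion_le_card_mul _ _ (t * m.choose t) fun w hw ↦ ?_).trans ?_
    · obtain ⟨hwc, hwlen⟩ := List.mem_sublistsLen.mp (List.mem_toFinset.mp hw)
      rw [Finset.card_erase_of_mem (hG w c hc hwc), Nat.sub_le_iff_le_add]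
      refine (hGcard w).trans ?_
      rw [hwlen, show m + 1 - (m - t) = t + 1 by omega, Finset.sum_range_succ',
        Nat.choose_zero_right]
      gcongr
      refine (Finset.sum_le_card_nsmul _ _ (m.choose t) fun i hi ↦ ?_).trans (by simp)
      exact choose_le_choose_of_le_half (by simpa using hi) ht
    · rw [hchoose]
      calc _ ≤ m.choose t * (t * m.choose t) := by gcongr
        _ = _ := by ring

/-- A finite set on which a symmetric relation has degree at most `d` contains an independent
subset of proportion at least `1 / (d + 1)`. -/
lemma exists_independent_subset {α : Type*} [DecidableEq α] (r : α → α → Prop)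
    (hr : ∀ x y, r x y → r y x) (S : Finset α) (d : ℕ)
    (hd : ∀ x ∈ S, ∃ F : Finset α, (∀ y ∈ S, y ≠ x → r x y → y ∈ F) ∧ F.card ≤ d) :
    ∃ C ⊆ S, (∀ x ∈ C, ∀ y ∈ C, x ≠ y → ¬ r x y) ∧ S.card ≤ C.card * (d + 1) := by
  induction S using Finset.strongInduction with
  | H S ih =>
    rcases S.eq_empty_or_nonempty with rfl | ⟨x, hx⟩
    · exact ⟨∅, by simp⟩
    obtain ⟨F, hF, hFcard⟩ := hd x hx
    have hss : S \ insert x F ⊆ S := Finset.sdiff_subset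
    obtain ⟨C, hCS, hC, hcard⟩ := ih (S \ insert x F)
      (Finset.ssubset_iff_subset_ne.mpr ⟨hss, fun h ↦ by
        rw [← h] at hx
        simp at hx⟩)
      fun y hy ↦ by
        obtain ⟨F', hF', hF'card⟩ := hd y (hss hy)
        exact ⟨F', fun z hz ↦ hF' z (hss hz), hF'card⟩
    have hxC : ∀ y ∈ C, ¬ r x y := fun y hy hxy ↦ by
      have := hCS hy
      simp only [Finset.mem_sdiff, Finset.mem_insert, not_or] at this
      exact this.2.2 (hF y this.1 this.2.1 hxy)
    have hx_notMem : x ∉ C := fun h ↦ by simpa using hCS h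
    refine ⟨insert x C, Finset.insert_subset hx (hCS.trans hss), ?_, ?_⟩
    · intro y hy z hz hyz
      rcases Finset.mem_insert.mp hy with hyx | hyC <;>
        rcases Finset.mem_insert.mp hz with hzx | hzC
      · exact absurd (hyx.trans hzx.symm) hyz
      · exact hyx ▸ hxC z hzC
      · exact fun h ↦ hxC y hyC (hr _ _ (hzx ▸ h))
      · exact hC y hyC z hzC hyz
    · rw [Finset.card_insert_of_notMem hx_notMem, add_one_mul]
      have h₁ := Finset.card_le_card_sdiff_add_card (s := S) (t := insert x F)
      have h₂ := Finset.card_insert_le x F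
      omega

/-- Paper's Lemma 3.2 (quantitative content): for `0 < δ < 1/2` and `m` with `t = δm`
an integer, there is a code `C ⊆ {0,1}^m` whose codewords have all runs of length 1
or 2, no two distinct codewords of which share a common subsequence of length at least
`m - t` (so `C` corrects a `δ` fraction of adversarial insertions and deletions), with
`|C| ≥ 2·fib(m+1) / (t·C(m, m-t)² + 1)`. -/
theorem greedy_deletion_code_short_runs (δ : ℝ) (hδ : 0 < δ) (hδ' : δ < 1 / 2)
    (m : ℕ) (hm : 0 < m) (t : ℕ) (ht : (t : ℝ) = δ * m) :
    ∃ C : Finset (List Bool),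
      (∀ c ∈ C, c.length = m ∧ runsLenOneOrTwo c) ∧
      (∀ c ∈ C, ∀ c' ∈ C, c ≠ c' →
        ¬ ∃ w : List Bool, m - t ≤ w.length ∧ w.Sublist c ∧ w.Sublist c') ∧
      (C.card : ℝ) ≥ 2 * Nat.fib (m + 1) / (t * (m.choose (m - t)) ^ 2 + 1) := by
  have htm : 2 * t ≤ m := by
    have : (2 * t : ℝ) ≤ m := by
      rw [ht]
      nlinarith [(Nat.cast_nonneg m : (0 : ℝ) ≤ m)]
    exact_mod_cast this
  have hS : ∀ c ∈ shortRunWords true m ∪ shortRunWords false m,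
      c.length = m ∧ runsLenOneOrTwo c := by
    intro c hc
    rcases Finset.mem_union.mp hc with hc | hc <;>
      exact ⟨length_of_mem_shortRunWords _ _ _ hc, runsLenOneOrTwo_of_mem_shortRunWords _ _ _ hc⟩
  obtain ⟨C, hCS, hC, hcard⟩ := exists_independent_subset
    (fun c c' : List Bool ↦ ∃ w : List Bool, m - t ≤ w.length ∧ w.Sublist c ∧ w.Sublist c')
    (fun c c' ⟨w, hw, h, h'⟩ ↦ ⟨w, hw, h', h⟩)
    (shortRunWords true m ∪ shortRunWords false m) (t * m.choose (m - t) ^ 2)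
    fun c hc ↦ by
      obtain ⟨F, hF, hFcard⟩ := exists_finset_confusable htm (hS c hc).1
      exact ⟨F, fun v hv ↦ hF v (hS v hv).1, hFcard⟩
  refine ⟨C, fun c hc ↦ hS c (hCS hc), hC, ?_⟩
  rw [Finset.card_union_of_disjoint (disjoint_shortRunWords hm), card_shortRunWords,
    card_shortRunWords, ← two_mul] at hcard
  rw [ge_iff_le, div_le_iff₀ (by positivity)]
  exact_mod_cast hcard
end

section
/- There exists a positive integer m₀ such that for every m ≥ m₀ there is a code C ⊆ {0,1}^m satisfying: (i) every codeword has all runs of length 1 or 2; (ii) every codeword begins with the symbol 1 and ends with the symbol 1; (iii) no two distinct codewords of C have a common subsequence of length at least m − ⌊0.0083·m⌋; and (iv) |C| ≥ 2^{0.555·m}. -/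
/-- Words of length `n` with all runs of length one or two, starting with `b` and ending with
`true`; the empty word counts as starting with `false`. -/
def runWords : Bool → ℕ → Finset (List Bool)
  | true, 0 => ∅
  | false, 0 => {[]}
  | true, 1 => {[true]}
  | false, 1 => ∅
  | b, n + 2 => (runWords (!b) (n + 1)).image (b :: ·) ∪ (runWords (!b) n).image (b :: b :: ·)

theorem runWords_add_two (b : Bool) (n : ℕ) :
    runWords b (n + 2) =
      (runWords (!b) (n + 1)).image (b :: ·) ∪ (runWords (!b) n).image (b :: b :: ·) := by
  cases b <;> rfl

theorem runsLenOneOrTwo_cons_cons {b : Bool} {d : List Bool} (hd : runsLenOneOrTwo d)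
    (hb : ∀ a ∈ d.head?, a = !b) : runsLenOneOrTwo (b :: b :: d) := by
  intro a ha
  rcases List.infix_cons_iff.1 ha with h | h
  · cases a <;> cases b <;> cases d <;> simp_all
  · rcases List.infix_cons_iff.1 h with h | h
    · cases a <;> cases b <;> cases d <;> simp_all
    · exact hd a h

theorem runWords_spec (n : ℕ) : ∀ (b : Bool), ∀ c ∈ runWords b n,
    c.length = n ∧ runsLenOneOrTwo c ∧ (∀ a ∈ c.head?, a = b) ∧
      ((!b) :: c).getLast? = some true := by
  induction n using Nat.twoStepInduction with
  | zero => intro b c hc; cases b <;> simp_all [runWords, runsLenOneOrTwo]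
  | one => intro b c hc; cases b <;> simp_all [runWords, runsLenOneOrTwo, List.infix_cons_iff]
  | more n ih₀ ih₁ =>
    intro b c hc
    rw [runWords_add_two, Finset.mem_union, Finset.mem_image, Finset.mem_image] at hc
    rcases hc with ⟨d, hd, rfl⟩ | ⟨d, hd, rfl⟩
    · obtain ⟨hl, hr, hh, he⟩ := ih₁ _ d hd
      exact ⟨by simp [hl], fun a ha => runsLenOneOrTwo_cons_cons hr hh a
        (ha.trans (List.suffix_cons _ _).isInfix), by simp, by simpa using he⟩
    · obtain ⟨hl, hr, hh, he⟩ := ih₀ _ d hd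
      exact ⟨by simp [hl], runsLenOneOrTwo_cons_cons hr hh, by simp, by simpa using he⟩

theorem card_runWords_add_two (b : Bool) (n : ℕ) :
    (runWords b (n + 2)).card = (runWords (!b) (n + 1)).card + (runWords (!b) n).card := by
  rw [runWords_add_two, Finset.card_union_of_disjoint, Finset.card_image_of_injective,
    Finset.card_image_of_injective]
  · intro x y h; simpa using h
  · intro x y h; simpa using h
  · rw [Finset.disjoint_left]
    intro c hc hc'
    obtain ⟨d, hd, rfl⟩ := Finset.mem_image.1 hc
    obtain ⟨e, he, h⟩ := Finset.mem_image.1 hc'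
    have := (runWords_spec _ _ d hd).2.2.1 b
    simp only [List.cons.injEq, true_and] at h
    subst h
    simp at this

theorem pow_le_card_runWords {r : ℝ} (hr : 1 ≤ r) (hr' : r ^ 2 ≤ r + 1) (n : ℕ) :
    ∀ b : Bool, r ^ n ≤ (runWords b (n + 2)).card * r := by
  induction n using Nat.twoStepInduction with
  | zero =>
    intro b
    cases b <;> simp [runWords, hr]
  | one =>
    intro b
    have h : 1 ≤ (runWords b (1 + 2)).card := by
      cases b <;> simp [runWords]
    have h' : (1 : ℝ) ≤ (runWords b (1 + 2)).card := by exact_mod_cast h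
    nlinarith
  | more n ih₀ ih₁ =>
    intro b
    rw [card_runWords_add_two b (n + 2)]
    push_cast
    have h₀ := ih₀ (!b)
    have h₁ := ih₁ (!b)
    have h₂ : r ^ (n + 2) ≤ r ^ (n + 1) + r ^ n := by
      calc r ^ (n + 2) = r ^ n * r ^ 2 := pow_add _ _ _
        _ ≤ r ^ n * (r + 1) := by gcongr
        _ = _ := by ring
    have h₃ : n + 2 + 1 = n + 1 + 2 := rfl
    rw [h₃]
    linarith

theorem card_le_card_preimage_cons (T : Finset (List Bool)) (hT : [] ∉ T) (b : Bool) :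
    T.card ≤ (T.preimage (b :: ·) (List.cons_injective.injOn)).card +
      (T.preimage ((!b) :: ·) (List.cons_injective.injOn)).card := by
  classical
  have hsub : T ⊆ (T.preimage (b :: ·) (List.cons_injective.injOn)).image (b :: ·) ∪
      (T.preimage ((!b) :: ·) (List.cons_injective.injOn)).image ((!b) :: ·) := by
    intro c hc
    cases c with
    | nil => exact absurd hc hT
    | cons a d => cases a <;> cases b <;> simpa using hc
  exact (Finset.card_le_card hsub).trans ((Finset.card_union_le _ _).trans
    (add_le_add Finset.card_image_le Finset.card_image_le))

/-- Exponentially weighted bound on the number of binary words of length `n` that contain a given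
subsequence. -/
theorem card_superseq_mul_pow_le {x : ℝ} (hx : 0 ≤ x) (hx1 : x ≤ 1) (n : ℕ) :
    ∀ (w : List Bool) (T : Finset (List Bool)), (∀ c ∈ T, c.length = n ∧ w.Sublist c) →
      T.card * x ^ n ≤ x ^ w.length * (1 + x) ^ n := by
  induction n with
  | zero =>
    intro w T hT
    rcases T.eq_empty_or_nonempty with rfl | ⟨c, hc⟩
    · simp only [Finset.card_empty, Nat.cast_zero, zero_mul]; positivity
    · have hcard : T.card ≤ 1 := Finset.card_le_one.2 fun a ha b hb => by
        rw [List.length_eq_zero_iff.1 (hT a ha).1, List.length_eq_zero_iff.1 (hT b hb).1]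
      have hw := (hT c hc).2.length_le
      rw [(hT c hc).1] at hw
      simpa [Nat.le_zero.1 hw] using hcard
  | succ n ih =>
    intro w T hT
    have hnil : [] ∉ T := fun h => by simpa using (hT _ h).1
    cases w with
    | nil =>
      have h₁ := ih [] (T.preimage (true :: ·) (List.cons_injective.injOn)) fun c hc => by
        simpa using (hT _ (Finset.mem_preimage.1 hc)).1
      have h₀ := ih [] (T.preimage ((!true) :: ·) (List.cons_injective.injOn)) fun c hc => by
        simpa using (hT _ (Finset.mem_preimage.1 hc)).1
      have hc : (T.card : ℝ) ≤ _ := Nat.cast_le.2 (card_le_card_preimage_cons T hnil true)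
      rw [Nat.cast_add] at hc
      have h := mul_le_mul_of_nonneg_right hc (pow_nonneg hx (n + 1))
      have h' := mul_le_mul_of_nonneg_left (add_le_add h₁ h₀) hx
      refine h.trans ((le_of_eq (by ring)).trans (h'.trans ?_))
      have hp : (0 : ℝ) ≤ (1 + x) ^ n := by positivity
      simp only [List.length_nil, pow_zero, one_mul]
      rw [pow_succ]
      nlinarith
    | cons a w =>
      have h₁ := ih w (T.preimage (a :: ·) (List.cons_injective.injOn)) fun c hc => by
        simpa using hT _ (Finset.mem_preimage.1 hc)
      have h₀ := ih (a :: w) (T.preimage ((!a) :: ·) (List.cons_injective.injOn)) fun c hc => by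
        obtain ⟨hl, hs⟩ := hT _ (Finset.mem_preimage.1 hc)
        refine ⟨by simpa using hl, ?_⟩
        rcases List.sublist_cons_iff.1 hs with h | ⟨_, h, -⟩
        · exact h
        · simp at h
      have hc : (T.card : ℝ) ≤ _ := Nat.cast_le.2 (card_le_card_preimage_cons T hnil a)
      rw [Nat.cast_add] at hc
      have h := mul_le_mul_of_nonneg_right hc (pow_nonneg hx (n + 1))
      have h' := mul_le_mul_of_nonneg_left (add_le_add h₁ h₀) hx
      refine h.trans ((le_of_eq (by ring)).trans (h'.trans (le_of_eq ?_)))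
      simp only [List.length_cons]
      ring

theorem choose_mul_pow_le_s8 {x : ℝ} (hx : 0 ≤ x) {n t : ℕ} (ht : t ≤ n) :
    (n.choose t : ℝ) * x ^ t ≤ (1 + x) ^ n := by
  rw [add_comm, add_pow]
  simp only [one_pow, mul_one]
  rw [mul_comm]
  exact Finset.single_le_sum (f := fun i => x ^ i * (n.choose i : ℝ))
    (fun i _ => by positivity) (Finset.mem_range.2 (Nat.lt_succ_of_le ht))

/-- The number of words of length `n` sharing with `c` a common subsequence of length `n - t`. -/
theorem card_common_subseq_mul_pow_le {x : ℝ} (hx : 0 < x) (hx1 : x ≤ 1) {n t : ℕ} (ht : t ≤ n)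
    (c : List Bool) (hc : c.length = n) (T : Finset (List Bool))
    (hT : ∀ d ∈ T, d.length = n ∧ ∃ w : List Bool, n - t ≤ w.length ∧ w.Sublist c ∧ w.Sublist d) :
    T.card * x ^ (2 * t) ≤ (1 + x) ^ (2 * n) := by
  classical
  have hsub : T ⊆ (List.sublistsLen (n - t) c).toFinset.biUnion
      fun w => T.filter fun d => w.Sublist d := by
    intro d hd
    obtain ⟨-, w, hw, hwc, hwd⟩ := hT d hd
    rw [Finset.mem_biUnion]
    refine ⟨w.take (n - t), ?_, Finset.mem_filter.2 ⟨hd, (List.take_sublist _ _).trans hwd⟩⟩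
    rw [List.mem_toFinset, List.mem_sublistsLen]
    exact ⟨(List.take_sublist _ _).trans hwc, by simpa using hw⟩
  have hfib : ∀ w ∈ (List.sublistsLen (n - t) c).toFinset,
      ((T.filter fun d => w.Sublist d).card : ℝ) * x ^ t ≤ (1 + x) ^ n := by
    intro w hw
    rw [List.mem_toFinset, List.mem_sublistsLen] at hw
    have h := card_superseq_mul_pow_le hx.le hx1 n w (T.filter fun d => w.Sublist d) fun d hd =>
      ⟨(hT d (Finset.mem_filter.1 hd).1).1, (Finset.mem_filter.1 hd).2⟩
    rw [hw.2] at h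
    have hp : 0 < x ^ (n - t) := by positivity
    refine le_of_mul_le_mul_left (le_trans (le_of_eq ?_) h) hp
    rw [mul_left_comm, ← pow_add, Nat.sub_add_cancel ht]
  have hlen : ((List.sublistsLen (n - t) c).toFinset.card : ℝ) ≤ n.choose t := by
    have h := List.toFinset_card_le (List.sublistsLen (n - t) c)
    rw [List.length_sublistsLen, hc, Nat.choose_symm ht] at h
    exact_mod_cast h
  have hcard : (T.card : ℝ) ≤ ∑ w ∈ (List.sublistsLen (n - t) c).toFinset,
      ((T.filter fun d => w.Sublist d).card : ℝ) := by
    exact_mod_cast (Finset.card_le_card hsub).trans Finset.card_biUnion_le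
  calc (T.card : ℝ) * x ^ (2 * t) = (T.card * x ^ t) * x ^ t := by ring
    _ ≤ ((∑ w ∈ (List.sublistsLen (n - t) c).toFinset,
          ((T.filter fun d => w.Sublist d).card : ℝ)) * x ^ t) * x ^ t := by gcongr
    _ ≤ (n.choose t * (1 + x) ^ n) * x ^ t := by
        rw [Finset.sum_mul]
        refine mul_le_mul_of_nonneg_right ((Finset.sum_le_sum hfib).trans ?_) (by positivity)
        rw [Finset.sum_const, nsmul_eq_mul]
        gcongr
    _ = (n.choose t * x ^ t) * (1 + x) ^ n := by ring
    _ ≤ (1 + x) ^ n * (1 + x) ^ n :=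
        mul_le_mul_of_nonneg_right (choose_mul_pow_le_s8 hx.le ht) (by positivity)
    _ = _ := by ring

/-- Gilbert–Varshamov bound: a symmetric reflexive conflict relation on a finite set `G`
admits a set of pairwise non-conflicting elements whose neighbourhoods cover `G`. -/
theorem exists_independent_cover {α : Type*} [DecidableEq α] (G : Finset α) (R : α → α → Prop)
    [DecidableRel R] (hrefl : ∀ a, R a a) (hsymm : ∀ a b, R a b → R b a) :
    ∃ C ⊆ G, (∀ a ∈ C, ∀ b ∈ C, a ≠ b → ¬ R a b) ∧ G ⊆ C.biUnion fun a => G.filter (R a) := by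
  obtain ⟨C, hC, hmax⟩ := Finset.exists_max_image
    (G.powerset.filter fun C => ∀ a ∈ C, ∀ b ∈ C, a ≠ b → ¬ R a b) Finset.card
    ⟨∅, by simp⟩
  rw [Finset.mem_filter, Finset.mem_powerset] at hC
  refine ⟨C, hC.1, hC.2, fun g hg => ?_⟩
  by_contra hcov
  have hno : ∀ a ∈ C, ¬ R a g := fun a ha h =>
    hcov (Finset.mem_biUnion.2 ⟨a, ha, Finset.mem_filter.2 ⟨hg, h⟩⟩)
  have hgC : g ∉ C := fun h => hno g h (hrefl g)
  have hle := hmax (insert g C) <| by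
    rw [Finset.mem_filter, Finset.mem_powerset]
    refine ⟨Finset.insert_subset hg hC.1, fun a ha b hb hab => ?_⟩
    rcases Finset.mem_insert.1 ha with rfl | ha' <;> rcases Finset.mem_insert.1 hb with rfl | hb'
    · exact absurd rfl hab
    · exact fun h => hno b hb' (hsymm _ _ h)
    · exact hno a ha'
    · exact hC.2 a ha' b hb' hab
  rw [Finset.card_insert_of_notMem hgC] at hle
  omega

theorem two_rpow_lt : (2 : ℝ) ^ (0.6712 : ℝ) < 1.618 * (128 / 129) ^ 2 := by
  have h : (2 : ℝ) ^ (0.6712 : ℝ) ≤ 2 ^ ((47 : ℝ) / 70) :=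
    Real.rpow_le_rpow_of_exponent_le (by norm_num) (by norm_num)
  refine h.trans_lt (lt_of_pow_lt_pow_left₀ 70 (by norm_num) ?_)
  rw [← Real.rpow_natCast, ← Real.rpow_mul (by norm_num)]
  have : (47 : ℝ) / 70 * (70 : ℕ) = (47 : ℕ) := by norm_num
  rw [this, Real.rpow_natCast]
  norm_num

/-- Paper's Corollary 3.4: there is `m₀` such that for every `m ≥ m₀` there is a code
`C ⊆ {0,1}^m` whose codewords have all runs of length 1 or 2 and start and end with a 1,
no two distinct codewords of which share a common subsequence of length at least
`m - ⌊0.0083·m⌋` (so `C` corrects a `0.0083` fraction of adversarial insertions and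
deletions), and `|C| ≥ 2^(0.555·m)`. -/
theorem inner_code_exists :
    ∃ m₀ : ℕ, 0 < m₀ ∧ ∀ m : ℕ, m₀ ≤ m →
      ∃ C : Finset (List Bool),
        (∀ c ∈ C, c.length = m ∧ runsLenOneOrTwo c ∧
          c.head? = some true ∧ c.getLast? = some true) ∧
        (∀ c ∈ C, ∀ c' ∈ C, c ≠ c' →
          ¬ ∃ w : List Bool, m - ⌊(0.0083 : ℝ) * m⌋₊ ≤ w.length ∧
            w.Sublist c ∧ w.Sublist c') ∧
        (C.card : ℝ) ≥ 2 ^ ((0.555 : ℝ) * m) := by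
  classical
  set q : ℝ := 1.618 * (128 / 129) ^ 2 / 2 ^ (0.6712 : ℝ) with hq
  have hβ : (0 : ℝ) < 2 ^ (0.6712 : ℝ) := by positivity
  have hq1 : 1 < q := (one_lt_div hβ).2 two_rpow_lt
  obtain ⟨N, hN⟩ := pow_unbounded_of_one_lt ((1.618 : ℝ) ^ 3) hq1
  refine ⟨N + 2, by omega, fun m hm => ?_⟩
  set t := ⌊(0.0083 : ℝ) * m⌋₊ with ht
  have htm' : (t : ℝ) ≤ 0.0083 * m := Nat.floor_le (by positivity)
  have htm : t ≤ m := by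
    have : (t : ℝ) ≤ m := htm'.trans (by linarith [Nat.cast_nonneg (α := ℝ) m])
    exact_mod_cast this
  obtain ⟨C, hCG, hCI, hcov⟩ := exists_independent_cover (runWords true m)
    (fun c c' => c.length = c'.length → ∃ w : List Bool, c.length - t ≤ w.length ∧
      w.Sublist c ∧ w.Sublist c')
    (fun c _ => ⟨c, by omega, List.Sublist.refl c, List.Sublist.refl c⟩)
    (fun c c' h e => by
      obtain ⟨w, h₁, h₂, h₃⟩ := h e.symm
      exact ⟨w, e ▸ h₁, h₃, h₂⟩)
  have hspec := runWords_spec m true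
  refine ⟨C, fun c hc => ?_, fun c hc c' hc' hne h => ?_, ?_⟩
  · obtain ⟨hl, hr, hh, he⟩ := hspec c (hCG hc)
    cases c with
    | nil => simp at hl; omega
    | cons a d => exact ⟨hl, hr, by simpa using hh a rfl, by simpa using he⟩
  · refine hCI c hc c' hc' hne fun _ => ?_
    rwa [(hspec c (hCG hc)).1]
  · have hball : ∀ c ∈ C, (((runWords true m).filter fun c' => c.length = c'.length →
        ∃ w : List Bool, c.length - t ≤ w.length ∧ w.Sublist c ∧ w.Sublist c').card : ℝ) *
          (1 / 128) ^ (2 * t) ≤ (1 + 1 / 128) ^ (2 * m) := by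
      intro c hc
      have hl := (hspec c (hCG hc)).1
      refine card_common_subseq_mul_pow_le (by norm_num) (by norm_num) htm c hl _ fun d hd => ?_
      rw [Finset.mem_filter] at hd
      have hd' := (hspec d hd.1).1
      refine ⟨hd', ?_⟩
      have := hd.2 (hl.trans hd'.symm)
      rwa [hl] at this
    have hcard := (Finset.card_le_card hcov).trans Finset.card_biUnion_le
    have hcard' : ((runWords true m).card : ℝ) * (1 / 128) ^ (2 * t) ≤
        C.card * (1 + 1 / 128) ^ (2 * m) := by
      refine (mul_le_mul_of_nonneg_right (Nat.cast_le.2 hcard) (by positivity)).trans ?_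
      rw [Nat.cast_sum, Finset.sum_mul]
      refine (Finset.sum_le_sum hball).trans ?_
      rw [Finset.sum_const, nsmul_eq_mul]
    have hG : (1.618 : ℝ) ^ m ≤ (runWords true m).card * 1.618 ^ 3 := by
      obtain ⟨k, rfl⟩ := Nat.exists_eq_add_of_le' (show 2 ≤ m by omega)
      have := pow_le_card_runWords (r := 1.618) (by norm_num) (by norm_num) k true
      calc (1.618 : ℝ) ^ (k + 2) = 1.618 ^ k * 1.618 ^ 2 := pow_add _ _ _
        _ ≤ ((runWords true (k + 2)).card * 1.618) * 1.618 ^ 2 := by gcongr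
        _ = _ := by ring
    have hx : (2 : ℝ) ^ (-(0.1162 * m) : ℝ) ≤ (1 / 128) ^ (2 * t) := by
      have : (1 / 128 : ℝ) ^ (2 * t) = 2 ^ (-(14 * t) : ℝ) := by
        rw [show (1 / 128 : ℝ) = (2 ^ 7)⁻¹ by norm_num, inv_pow, ← pow_mul,
          Real.rpow_neg (by norm_num), ← Real.rpow_natCast]
        congr 2
        push_cast
        ring
      rw [this]
      exact Real.rpow_le_rpow_of_exponent_le (by norm_num) (by linarith)
    have hqm : (1.618 : ℝ) ^ 3 ≤ q ^ m :=
      hN.le.trans (pow_le_pow_right₀ hq1.le (by omega))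
    have hsplit : (1.618 : ℝ) ^ m * 2 ^ (-(0.1162 * m) : ℝ) =
        q ^ m * 2 ^ ((0.555 : ℝ) * m) * (1 + 1 / 128) ^ (2 * m) := by
      have e₁ : (2 : ℝ) ^ ((0.555 : ℝ) * m) =
          (2 ^ (0.6712 : ℝ)) ^ m * 2 ^ (-(0.1162 * m) : ℝ) := by
        rw [← Real.rpow_mul_natCast (by norm_num), ← Real.rpow_add (by norm_num)]
        congr 1
        ring
      have e₂ : q * 2 ^ (0.6712 : ℝ) * (1 + 1 / 128) ^ 2 = 1.618 := by
        rw [hq, div_mul_cancel₀ _ hβ.ne']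
        norm_num
      rw [e₁, ← e₂, pow_mul, mul_pow, mul_pow]
      ring
    have hpos : (0 : ℝ) < 1.618 ^ 3 * (1 + 1 / 128) ^ (2 * m) := by positivity
    refine le_of_mul_le_mul_right ?_ hpos
    calc (2 : ℝ) ^ ((0.555 : ℝ) * m) * (1.618 ^ 3 * (1 + 1 / 128) ^ (2 * m))
        ≤ 2 ^ ((0.555 : ℝ) * m) * (q ^ m * (1 + 1 / 128) ^ (2 * m)) := by gcongr
      _ = 1.618 ^ m * 2 ^ (-(0.1162 * m) : ℝ) := by rw [hsplit]; ring
      _ ≤ ((runWords true m).card * 1.618 ^ 3) * (1 / 128) ^ (2 * t) := by gcongr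
      _ = ((runWords true m).card * (1 / 128) ^ (2 * t)) * 1.618 ^ 3 := by ring
      _ ≤ (C.card * (1 + 1 / 128) ^ (2 * m)) * 1.618 ^ 3 := by gcongr
      _ = _ := by ring
end

section
/- (Levenshtein's distance formula.) For any two words w₁ and w₂ over a (fixed) alphabet, the insertion/deletion distance Δ_id(w₁, w₂) — the least n such that w₂ can be obtained from w₁ by a sequence of n operations, each of which either deletes one symbol or inserts one symbol at an arbitrary position — equals |w₁| + |w₂| − 2·LCS(w₁, w₂), where LCS(w₁, w₂) is the maximum length of a word that is a subsequence of both w₁ and w₂. -/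
/-- One edit step: delete a single symbol from a word, or insert a single symbol at an
arbitrary position. -/
def EditStep {α : Type*} (s t : List α) : Prop :=
  (∃ (l r : List α) (a : α), s = l ++ a :: r ∧ t = l ++ r) ∨
  (∃ (l r : List α) (a : α), s = l ++ r ∧ t = l ++ a :: r)

/-- `w₂` can be obtained from `w₁` by a sequence of exactly `n` single-symbol
insertions/deletions. -/
def ReachableIn {α : Type*} (w₁ w₂ : List α) (n : ℕ) : Prop :=
  ∃ f : Fin (n + 1) → List α, f 0 = w₁ ∧ f (Fin.last n) = w₂ ∧
    ∀ i : Fin n, EditStep (f i.castSucc) (f i.succ)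

/-- The length of a longest common subsequence of `w₁` and `w₂`. -/
noncomputable def lcsLen {α : Type*} (w₁ w₂ : List α) : ℕ :=
  sSup {k | ∃ w : List α, w.Sublist w₁ ∧ w.Sublist w₂ ∧ w.length = k}

theorem EditStep.symm {α : Type*} {s t : List α} (h : EditStep s t) : EditStep t s := by
  rcases h with ⟨l, r, a, hs, ht⟩ | ⟨l, r, a, hs, ht⟩
  · exact Or.inr ⟨l, r, a, ht, hs⟩
  · exact Or.inl ⟨l, r, a, ht, hs⟩

theorem EditStep.cons {α : Type*} {s t : List α} (b : α) (h : EditStep s t) :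
    EditStep (b :: s) (b :: t) := by
  rcases h with ⟨l, r, a, rfl, rfl⟩ | ⟨l, r, a, rfl, rfl⟩
  · exact Or.inl ⟨b :: l, r, a, rfl, rfl⟩
  · exact Or.inr ⟨b :: l, r, a, rfl, rfl⟩

theorem reachableIn_zero {α : Type*} {s t : List α} : ReachableIn s t 0 ↔ s = t := by
  constructor
  · rintro ⟨f, rfl, rfl, -⟩
    rfl
  · rintro rfl
    exact ⟨fun _ => s, rfl, rfl, fun i => i.elim0⟩

theorem reachableIn_succ {α : Type*} {s t : List α} {n : ℕ} :
    ReachableIn s t (n + 1) ↔ ∃ u, EditStep s u ∧ ReachableIn u t n := by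
  constructor
  · rintro ⟨f, rfl, rfl, hf⟩
    exact ⟨f 1, hf 0, fun i => f i.succ, rfl, rfl, fun i => hf i.succ⟩
  · rintro ⟨u, hu, f, rfl, rfl, hf⟩
    refine ⟨Fin.cons s f, rfl, rfl, fun i => ?_⟩
    induction i using Fin.cases with
    | zero => exact hu
    | succ i => exact hf i

theorem ReachableIn.trans {α : Type*} {s t u : List α} {m n : ℕ}
    (h : ReachableIn s t m) (h' : ReachableIn t u n) : ReachableIn s u (m + n) := by
  induction m generalizing s with
  | zero =>
    obtain rfl := reachableIn_zero.1 h
    rwa [zero_add]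
  | succ m ih =>
    obtain ⟨v, hv, hvt⟩ := reachableIn_succ.1 h
    rw [Nat.add_right_comm]
    exact reachableIn_succ.2 ⟨v, hv, ih hvt⟩

theorem ReachableIn.symm {α : Type*} {s t : List α} {n : ℕ} (h : ReachableIn s t n) :
    ReachableIn t s n := by
  obtain ⟨f, rfl, rfl, hf⟩ := h
  refine ⟨fun i => f i.rev, by simp, by simp, fun i => ?_⟩
  simp only [Fin.rev_castSucc, Fin.rev_succ]
  exact (hf i.rev).symm

theorem ReachableIn.cons {α : Type*} {s t : List α} {n : ℕ} (b : α) (h : ReachableIn s t n) :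
    ReachableIn (b :: s) (b :: t) n := by
  obtain ⟨f, rfl, rfl, hf⟩ := h
  exact ⟨fun i => b :: f i, rfl, rfl, fun i => (hf i).cons b⟩

theorem List.Sublist.reachableIn {α : Type*} {w s : List α} (h : w.Sublist s) :
    ReachableIn s w (s.length - w.length) := by
  induction h with
  | slnil => exact reachableIn_zero.2 rfl
  | @cons w s a h ih =>
    rw [List.length_cons, Nat.succ_sub h.length_le]
    exact reachableIn_succ.2 ⟨s, Or.inl ⟨[], s, a, rfl, rfl⟩, ih⟩
  | cons_cons a h ih => simpa using ih.cons a

/-- Removing one symbol from a word shortens its subsequences by at most one symbol. -/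
theorem List.Sublist.exists_sublist_append {α : Type*} {w l r : List α} {a : α}
    (h : w.Sublist (l ++ a :: r)) :
    ∃ v : List α, v.Sublist w ∧ v.Sublist (l ++ r) ∧ w.length ≤ v.length + 1 := by
  obtain ⟨x, y, rfl, hx, hy⟩ := List.sublist_append_iff.1 h
  rcases List.sublist_cons_iff.1 hy with hy | ⟨z, rfl, hz⟩
  · exact ⟨x ++ y, .refl _, hx.append hy, Nat.le_succ _⟩
  · exact ⟨x ++ z, (List.Sublist.refl x).append (List.sublist_cons_self a z), hx.append hz,
      by simp [Nat.add_assoc]⟩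

theorem ReachableIn.exists_common_sublist {α : Type*} {s t : List α} {n : ℕ}
    (h : ReachableIn s t n) :
    ∃ w : List α, w.Sublist s ∧ w.Sublist t ∧ s.length + t.length ≤ n + 2 * w.length := by
  induction n generalizing s with
  | zero =>
    obtain rfl := reachableIn_zero.1 h
    exact ⟨s, .refl s, .refl s, by omega⟩
  | succ n ih =>
    obtain ⟨u, hsu, hut⟩ := reachableIn_succ.1 h
    obtain ⟨w, hwu, hwt, hlen⟩ := ih hut
    rcases hsu with ⟨l, r, a, rfl, rfl⟩ | ⟨l, r, a, rfl, rfl⟩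
    · refine ⟨w, hwu.trans ((List.Sublist.refl l).append (List.sublist_cons_self a r)), hwt, ?_⟩
      simp only [List.length_append, List.length_cons] at hlen ⊢
      omega
    · obtain ⟨v, hvw, hv, hle⟩ := hwu.exists_sublist_append
      refine ⟨v, hv, hvw.trans hwt, ?_⟩
      simp only [List.length_append, List.length_cons] at hlen ⊢
      omega

theorem bddAbove_length_common_sublist {α : Type*} (w₁ w₂ : List α) :
    BddAbove {k | ∃ w : List α, w.Sublist w₁ ∧ w.Sublist w₂ ∧ w.length = k} :=
  ⟨w₁.length, by rintro _ ⟨w, h, -, rfl⟩; exact h.length_le⟩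

theorem length_le_lcsLen {α : Type*} {w w₁ w₂ : List α} (h₁ : w.Sublist w₁)
    (h₂ : w.Sublist w₂) : w.length ≤ lcsLen w₁ w₂ :=
  le_csSup (bddAbove_length_common_sublist w₁ w₂) ⟨w, h₁, h₂, rfl⟩

theorem exists_length_eq_lcsLen {α : Type*} (w₁ w₂ : List α) :
    ∃ w : List α, w.Sublist w₁ ∧ w.Sublist w₂ ∧ w.length = lcsLen w₁ w₂ := by
  have hne : {k | ∃ w : List α, w.Sublist w₁ ∧ w.Sublist w₂ ∧ w.length = k}.Nonempty :=
    ⟨0, [], List.nil_sublist _, List.nil_sublist _, rfl⟩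
  exact Nat.sSup_mem hne (bddAbove_length_common_sublist w₁ w₂)

/-- Levenshtein's formula: the insertion/deletion distance between two words `w₁` and
`w₂` — the least number of single-symbol insertions and deletions transforming `w₁`
into `w₂` — equals `|w₁| + |w₂| - 2·LCS(w₁, w₂)`. -/
theorem insDel_dist_eq {α : Type*} (w₁ w₂ : List α) :
    IsLeast {n : ℕ | ReachableIn w₁ w₂ n}
      (w₁.length + w₂.length - 2 * lcsLen w₁ w₂) := by
  constructor
  · obtain ⟨w, h₁, h₂, hw⟩ := exists_length_eq_lcsLen w₁ w₂
    have hlen : w₁.length + w₂.length - 2 * lcsLen w₁ w₂ =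
        (w₁.length - w.length) + (w₂.length - w.length) := by
      have := h₁.length_le
      have := h₂.length_le
      omega
    rw [hlen]
    exact h₁.reachableIn.trans h₂.reachableIn.symm
  · intro n hn
    obtain ⟨w, h₁, h₂, hlen⟩ := ReachableIn.exists_common_sublist hn
    have := length_le_lcsLen h₁ h₂
    omega
end
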